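/- arXiv:2010.09837 — 8 statements merged into one kernel-verified Lean document; each statement's English description precedes it below -/
import Mathlib

section
/- Characterization of the isotropy group of the free quandle on n generators: for any rack term t over the generator set {x, y_1, …, y_n}, the class [t] belongs to G_Qnd(n) if and only if there exist m ≥ 0, indices i_1, …, i_m ∈ {1, …, n} and signs ε_1, …, ε_m ∈ {1, −1} such that t ~Q x ◁^{ε_1} y_{i_1} ◁^{ε_2} … ◁^{ε_m} y_{i_m} (left-associated) and the group word y_{i_1}^{ε_1} ⋯ y_{i_m}^{ε_m} is reduced. -/
/-- Closed terms over the signature of racks/quandles, with one generator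
constant for each element of `X`, and two binary operations `tri` (`◁`) and
`triInv` (`◁⁻¹`). -/
inductive RackTerm (X : Type) : Type
  | gen : X → RackTerm X
  | tri : RackTerm X → RackTerm X → RackTerm X
  | triInv : RackTerm X → RackTerm X → RackTerm X

namespace RackTerm

/-- `a ◁^ε b`: `◁` when `ε = true` (exponent `+1`), `◁⁻¹` when `ε = false`
(exponent `-1`). -/
def triE {X : Type} (ε : Bool) (a b : RackTerm X) : RackTerm X :=
  if ε then a.tri b else a.triInv b

/-- Simultaneous substitution of terms for generator constants. -/
def bind {X Y : Type} : RackTerm X → (X → RackTerm Y) → RackTerm Y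
  | gen x, f => f x
  | tri a b, f => (a.bind f).tri (b.bind f)
  | triInv a b, f => (a.bind f).triInv (b.bind f)

/-- `t.subst x s` is `t[s/x]`: the substitution of `s` for every occurrence of
the generator `x` in `t`. -/
def subst {X : Type} [DecidableEq X] (t : RackTerm X) (x : X) (s : RackTerm X) : RackTerm X :=
  t.bind fun a => if a = x then s else gen a

/-- The left-associated chain `t ◁^{ε₁} z₁ ◁^{ε₂} ⋯ ◁^{εₘ} zₘ`, where the word
is the list of pairs `(zⱼ, εⱼ)`. -/
def chain {X : Type} (t : RackTerm X) : List (X × Bool) → RackTerm X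
  | [] => t
  | p :: l => chain (t.triE p.2 (gen p.1)) l

/-- The leftmost generator of a term. -/
def left {X : Type} : RackTerm X → X
  | gen x => x
  | tri a _ => a.left
  | triInv a _ => a.left

end RackTerm

/-- A word (a finite list of pairs (generator, exponent `±1`), where `true`
codes `+1` and `false` codes `-1`) is reduced when it contains no adjacent pair
`(a, ε), (a, -ε)`. -/
def ReducedWord {X : Type} (w : List (X × Bool)) : Prop :=
  w.Chain' fun p q => p.1 = q.1 → p.2 = q.2

/-- The smallest congruence `~Q` on rack terms over `X`, compatible with `◁`
and `◁⁻¹`, containing all instances of the quandle axioms (self-distributivity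
of `◁` and of `◁⁻¹`, the two cancellation laws `(a ◁ b) ◁⁻¹ b = a` and
`(a ◁⁻¹ b) ◁ b = a`, and idempotence `a ◁ a = a`, `a ◁⁻¹ a = a`). -/
inductive QndRel (X : Type) : RackTerm X → RackTerm X → Prop
  | refl (a : RackTerm X) : QndRel X a a
  | symm {a b : RackTerm X} : QndRel X a b → QndRel X b a
  | trans {a b c : RackTerm X} : QndRel X a b → QndRel X b c → QndRel X a c
  | congr_tri {a a' b b' : RackTerm X} : QndRel X a a' → QndRel X b b' →
      QndRel X (a.tri b) (a'.tri b')
  | congr_triInv {a a' b b' : RackTerm X} : QndRel X a a' → QndRel X b b' →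
      QndRel X (a.triInv b) (a'.triInv b')
  | self_distrib (a b c : RackTerm X) : QndRel X ((a.tri b).tri c) ((a.tri c).tri (b.tri c))
  | self_distrib_inv (a b c : RackTerm X) :
      QndRel X ((a.triInv b).triInv c) ((a.triInv c).triInv (b.triInv c))
  | cancel (a b : RackTerm X) : QndRel X ((a.tri b).triInv b) a
  | cancel_inv (a b : RackTerm X) : QndRel X ((a.triInv b).tri b) a
  | idem (a : RackTerm X) : QndRel X (a.tri a) a
  | idem_inv (a : RackTerm X) : QndRel X (a.triInv a) a

/-- The generator set `{x, y₁, …, yₙ}`: `none` is the extra generator `x`, and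
`some i` is the generator `yᵢ`. -/
abbrev XY (n : ℕ) : Type := Option (Fin n)

/-- The generator set `{x₀, x₁, y₁, …, yₙ}`: `Sum.inl false` is `x₀`,
`Sum.inl true` is `x₁`, and `Sum.inr i` is `yᵢ`. -/
abbrev XXY (n : ℕ) : Type := Bool ⊕ Fin n

/-- The substitution sending the generator `x` to the term `s` and each
generator `yᵢ` to itself (as a generator of `{x₀, x₁, y₁, …, yₙ}`). -/
def genMap (n : ℕ) (s : RackTerm (XXY n)) : XY n → RackTerm (XXY n) :=
  fun a => a.elim s fun i => .gen (.inr i)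

/-- The membership predicate for the logical isotropy group `G_Qnd(n)` of the
free quandle on `n` generators: `[t] ∈ G_Qnd(n)` iff (i) `[t]` is invertible,
i.e. there is `t⁻¹` with `t[t⁻¹/x] ~Q x ~Q t⁻¹[t/x]`, and (ii) `[t]` commutes
generically with `◁` and `◁⁻¹`, i.e.
`t[(x₀ ◁^ε x₁)/x] ~Q t[x₀/x] ◁^ε t[x₁/x]` for `ε = ±1`. -/
def IsQndIsotropy (n : ℕ) (t : RackTerm (XY n)) : Prop :=
  (∃ tinv : RackTerm (XY n),
      QndRel (XY n) (t.subst none tinv) (.gen none) ∧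
      QndRel (XY n) (tinv.subst none t) (.gen none)) ∧
  (∀ ε : Bool,
      QndRel (XXY n)
        (t.bind (genMap n ((RackTerm.gen (.inl false)).triE ε (.gen (.inl true)))))
        ((t.bind (genMap n (.gen (.inl false)))).triE ε
          (t.bind (genMap n (.gen (.inl true))))))

namespace FQ

open RackTerm

theorem centralizer_gen {X : Type} [DecidableEq X] (x : X) :
    ∀ (m : ℕ) (g : FreeGroup X), g.toWord.length ≤ m →
      g * FreeGroup.of x = FreeGroup.of x * g → ∃ k : ℤ, g = FreeGroup.of x ^ k := by
  intro m
  induction m with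
  | zero =>
    intro g hg _
    have : g.toWord = [] := List.length_eq_zero_iff.mp (by omega)
    exact ⟨0, by simpa using FreeGroup.toWord_eq_nil_iff.mp this⟩
  | succ m ih =>
    intro g hg hc
    rcases hL : g.toWord with _ | ⟨⟨z, b⟩, L⟩
    · exact ⟨0, by simpa using FreeGroup.toWord_eq_nil_iff.mp hL⟩
    · have hgm : g = FreeGroup.mk ((z, b) :: L) := by rw [← hL, FreeGroup.mk_toWord]
      have hred : FreeGroup.IsReduced ((z, b) :: L) := hL ▸ FreeGroup.isReduced_toWord
      by_cases hz : z = x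
      · subst hz
        have hgL : g = FreeGroup.mk [(z, b)] * FreeGroup.mk L := by
          rw [hgm, FreeGroup.mul_mk]; rfl
        obtain ⟨j, hj⟩ : ∃ j : ℤ, FreeGroup.mk [(z, b)] = FreeGroup.of z ^ j := by
          cases b
          · exact ⟨-1, by simp [FreeGroup.of, FreeGroup.inv_mk, FreeGroup.invRev]⟩
          · exact ⟨1, by simp [FreeGroup.of]⟩
        rw [hj] at hgL
        have hlen : (FreeGroup.mk L).toWord.length ≤ m := by
          have h1 : (FreeGroup.mk L).toWord.length ≤ L.length := by
            rw [FreeGroup.toWord_mk]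
            exact (FreeGroup.Red.sublist FreeGroup.reduce.red).length_le
          rw [hL] at hg
          simp at hg
          omega
        have hcL : FreeGroup.mk L * FreeGroup.of z = FreeGroup.of z * FreeGroup.mk L := by
          rw [hgL] at hc
          have h2 : FreeGroup.of z ^ j * (FreeGroup.mk L * FreeGroup.of z)
              = FreeGroup.of z ^ j * (FreeGroup.of z * FreeGroup.mk L) := by
            rw [← mul_assoc, hc, ← mul_assoc, ← mul_assoc]
            congr 1
            exact ((Commute.refl (FreeGroup.of z)).zpow_right j).eq
          exact mul_left_cancel h2
        obtain ⟨k, hk⟩ := ih _ hlen hcL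
        exact ⟨j + k, by rw [hgL, hk, zpow_add]⟩
      · exfalso
        have h1 : (FreeGroup.of x * g).toWord = (x, true) :: (z, b) :: L := by
          rw [hgm, FreeGroup.of, FreeGroup.mul_mk, FreeGroup.toWord_mk]
          apply FreeGroup.IsReduced.reduce_eq
          show FreeGroup.IsReduced ((x, true) :: (z, b) :: L)
          rw [FreeGroup.isReduced_cons_cons]
          exact ⟨fun h => absurd h.symm hz, hred⟩
        have h2 : List.Sublist (g * FreeGroup.of x).toWord (((z, b) :: L) ++ [(x, true)]) := by
          rw [hgm, FreeGroup.of, FreeGroup.mul_mk, FreeGroup.toWord_mk]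
          exact FreeGroup.Red.sublist FreeGroup.reduce.red
        rw [hc, h1] at h2
        have h3 := h2.eq_of_length (by simp)
        simp at h3
        exact hz h3.1.1.symm

theorem centralizer {X : Type} (x : X) (g : FreeGroup X)
    (h : g * FreeGroup.of x = FreeGroup.of x * g) : ∃ k : ℤ, g = FreeGroup.of x ^ k := by
  classical
  exact centralizer_gen x _ g le_rfl h

theorem conj_gen {X : Type} {x y : X} {g h : FreeGroup X}
    (e : g * FreeGroup.of x * g⁻¹ = h * FreeGroup.of y * h⁻¹) : x = y := by
  classical
  by_contra hne
  have := congrArg (FreeGroup.lift (fun z => Multiplicative.ofAdd (if z = x then (1:ℤ) else 0))) e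
  simp only [map_mul, map_inv, FreeGroup.lift_apply_of, mul_inv_cancel_comm] at this
  have h2 := congrArg Multiplicative.toAdd this
  simp [Ne.symm hne] at h2

def ev {X : Type} : RackTerm X → FreeGroup X
  | gen x => FreeGroup.of x
  | tri a b => ev b * ev a * (ev b)⁻¹
  | triInv a b => (ev b)⁻¹ * ev a * ev b

theorem ev_rel {X : Type} {a b : RackTerm X} (h : QndRel X a b) : ev a = ev b := by
  induction h with
  | refl => rfl
  | symm _ ih => exact ih.symm
  | trans _ _ h1 h2 => exact h1.trans h2
  | congr_tri _ _ h1 h2 => simp only [ev, h1, h2]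
  | congr_triInv _ _ h1 h2 => simp only [ev, h1, h2]
  | _ => simp only [ev]; group

theorem ev_bind {X Y : Type} (t : RackTerm X) (f : X → RackTerm Y) :
    ev (t.bind f) = FreeGroup.lift (fun x => ev (f x)) (ev t) := by
  induction t with
  | gen x => simp [RackTerm.bind, ev]
  | tri a b h1 h2 => simp [RackTerm.bind, ev, h1, h2]
  | triInv a b h1 h2 => simp [RackTerm.bind, ev, h1, h2]

def std (X : Type) : Setoid (RackTerm X) := ⟨QndRel X, .refl, .symm, .trans⟩

abbrev Q (X : Type) := Quotient (std X)

def cl {X : Type} (t : RackTerm X) : Q X := Quotient.mk (std X) t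

theorem cl_eq {X : Type} {a b : RackTerm X} : cl a = cl b ↔ QndRel X a b :=
  ⟨fun h => Quotient.exact h, fun h => Quotient.sound h⟩

/-- Right multiplication by a term, as a permutation of the quotient. -/
def rm {X : Type} (b : RackTerm X) : Equiv.Perm (Q X) where
  toFun := Quotient.map (fun a => a.tri b) (fun _ _ h => QndRel.congr_tri h (.refl b))
  invFun := Quotient.map (fun a => a.triInv b) (fun _ _ h => QndRel.congr_triInv h (.refl b))
  left_inv := by
    rintro ⟨a⟩
    exact cl_eq.mpr (.cancel a b)
  right_inv := by
    rintro ⟨a⟩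
    exact cl_eq.mpr (.cancel_inv a b)

theorem rm_cl {X : Type} (a b : RackTerm X) : rm b (cl a) = cl (a.tri b) := rfl

theorem rm_inv_cl {X : Type} (a b : RackTerm X) : (rm b)⁻¹ (cl a) = cl (a.triInv b) := rfl

theorem rm_congr {X : Type} {b c : RackTerm X} (h : QndRel X b c) : rm b = rm c := by
  ext q
  obtain ⟨a, rfl⟩ := Quotient.exists_rep q
  exact cl_eq.mpr (.congr_tri (.refl a) h)

theorem rm_tri {X : Type} (b c : RackTerm X) : rm (b.tri c) = rm c * rm b * (rm c)⁻¹ := by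
  rw [eq_mul_inv_iff_mul_eq]
  ext q
  obtain ⟨a, rfl⟩ := Quotient.exists_rep q
  exact cl_eq.mpr (QndRel.self_distrib a b c).symm

theorem rm_triInv {X : Type} (b c : RackTerm X) : rm (b.triInv c) = (rm c)⁻¹ * rm b * rm c := by
  have h := rm_tri (b.triInv c) c
  rw [rm_congr (.cancel_inv b c)] at h
  rw [h]; group

def rho (X : Type) : FreeGroup X →* Equiv.Perm (Q X) := FreeGroup.lift fun x => rm (gen x)

theorem rho_ev {X : Type} (t : RackTerm X) : rho X (ev t) = rm t := by
  induction t with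
  | gen x => simp [rho, ev]
  | tri a b h1 h2 => simp only [ev, map_mul, map_inv, h1, h2, rm_tri]
  | triInv a b h1 h2 => simp only [ev, map_mul, map_inv, h1, h2, rm_triInv]

def evQ {X : Type} : Q X → FreeGroup X := Quotient.lift ev (fun _ _ h => ev_rel h)

theorem evQ_rm {X : Type} (b : RackTerm X) (q : Q X) :
    evQ (rm b q) = ev b * evQ q * (ev b)⁻¹ := by
  obtain ⟨a, rfl⟩ := Quotient.exists_rep q
  rfl

theorem evQ_rm_inv {X : Type} (b : RackTerm X) (q : Q X) :
    evQ ((rm b)⁻¹ q) = (ev b)⁻¹ * evQ q * ev b := by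
  obtain ⟨a, rfl⟩ := Quotient.exists_rep q
  rfl

theorem evQ_rho {X : Type} (g : FreeGroup X) : ∀ q : Q X,
    evQ (rho X g q) = g * evQ q * g⁻¹ := by
  induction g using FreeGroup.induction_on with
  | C1 => simp
  | of x =>
    intro q
    have : rho X (FreeGroup.of x) = rm (gen x) := by simp [rho]
    rw [this, evQ_rm]; rfl
  | inv_of x _ =>
    intro q
    have : rho X (FreeGroup.of x)⁻¹ = (rm (gen x))⁻¹ := by simp [rho]
    rw [this, evQ_rm_inv, inv_inv]; rfl
  | mul g h h1 h2 =>
    intro q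
    rw [map_mul, Equiv.Perm.mul_apply, h1, h2]; group

theorem exists_rep {X : Type} (t : RackTerm X) :
    ∃ (g : FreeGroup X) (z : X), cl t = rho X g (cl (gen z)) := by
  induction t with
  | gen x => exact ⟨1, x, by simp⟩
  | tri a b h1 _ =>
    obtain ⟨g, z, h⟩ := h1
    refine ⟨ev b * g, z, ?_⟩
    rw [map_mul, Equiv.Perm.mul_apply, ← h, rho_ev, rm_cl]
  | triInv a b h1 _ =>
    obtain ⟨g, z, h⟩ := h1
    refine ⟨(ev b)⁻¹ * g, z, ?_⟩
    rw [map_mul, Equiv.Perm.mul_apply, ← h, map_inv, rho_ev, rm_inv_cl]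

theorem ev_of_rep {X : Type} {t : RackTerm X} {g : FreeGroup X} {z : X}
    (h : cl t = rho X g (cl (gen z))) : ev t = g * FreeGroup.of z * g⁻¹ := by
  have := congrArg evQ h
  rw [evQ_rho] at this
  exact this

theorem rho_fix {X : Type} (z : X) (k : ℤ) :
    rho X (FreeGroup.of z ^ k) (cl (gen z)) = cl (gen z) := by
  have h : rho X (FreeGroup.of z) (cl (gen z)) = cl (gen z) := by
    have : rho X (FreeGroup.of z) = rm (gen z) := by simp [rho]
    rw [this, rm_cl]
    exact cl_eq.mpr (.idem _)
  rw [map_zpow]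
  exact Equiv.Perm.zpow_apply_eq_self_of_apply_eq_self h k

theorem rel_iff {X : Type} {a b : RackTerm X} : QndRel X a b ↔ ev a = ev b := by
  refine ⟨ev_rel, fun h => ?_⟩
  obtain ⟨g, z, hg⟩ := exists_rep a
  obtain ⟨g', z', hg'⟩ := exists_rep b
  rw [ev_of_rep hg, ev_of_rep hg'] at h
  obtain rfl := conj_gen h
  obtain ⟨k, hk⟩ := centralizer z (g'⁻¹ * g) (by
    have h2 : g'⁻¹ * (g * FreeGroup.of z * g⁻¹) * g = g'⁻¹ * (g' * FreeGroup.of z * g'⁻¹) * g := by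
      rw [h]
    calc _ = g'⁻¹ * (g * FreeGroup.of z * g⁻¹) * g := by group
      _ = _ := h2
      _ = _ := by group)
  rw [← cl_eq, hg, hg', show g = g' * FreeGroup.of z ^ k by rw [← hk]; group, map_mul,
    Equiv.Perm.mul_apply, rho_fix]

theorem chain_append {X : Type} (l l' : List (X × Bool)) : ∀ t : RackTerm X,
    t.chain (l ++ l') = (t.chain l).chain l' := by
  induction l with
  | nil => intro t; rfl
  | cons p l ih => intro t; exact ih _

theorem ev_chain {X : Type} (t : RackTerm X) (L : List (X × Bool)) :
    ev (t.chain L.reverse) = FreeGroup.mk L * ev t * (FreeGroup.mk L)⁻¹ := by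
  induction L with
  | nil => simp [RackTerm.chain, ← FreeGroup.one_eq_mk]
  | cons p L ih =>
    have hm : FreeGroup.mk (p :: L) = FreeGroup.mk [p] * FreeGroup.mk L := by
      rw [FreeGroup.mul_mk]; rfl
    rw [List.reverse_cons, chain_append, hm]
    obtain ⟨x, b⟩ := p
    cases b
    · have : FreeGroup.mk [(x, false)] = (FreeGroup.of x)⁻¹ := by
        simp [FreeGroup.of, FreeGroup.inv_mk, FreeGroup.invRev]
      rw [this]
      simp only [RackTerm.chain, triE, ev, ih, Bool.false_eq_true, if_false]
      group
    · have : FreeGroup.mk [(x, true)] = FreeGroup.of x := rfl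
      rw [this]
      simp only [RackTerm.chain, triE, ev, ih, if_true]
      group

theorem reduced_reverse {X : Type} {L : List (X × Bool)} (h : FreeGroup.IsReduced L) :
    ReducedWord L.reverse := by
  unfold ReducedWord
  refine List.isChain_reverse.mpr ?_
  exact List.IsChain.imp (fun a b h e => (h e.symm).symm) h

theorem ev_chain_some {n : ℕ} (L : List (Fin n × Bool)) :
    ev ((RackTerm.gen none).chain (L.reverse.map fun p => ((some p.1 : XY n), p.2))) =
      FreeGroup.map some (FreeGroup.mk L) * FreeGroup.of none *
        (FreeGroup.map some (FreeGroup.mk L))⁻¹ := by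
  rw [List.map_reverse, ev_chain, FreeGroup.map.mk]; rfl

theorem lift_map_some {n : ℕ} {G : Type} [Group G] (f : XY n → G) (W : FreeGroup (Fin n)) :
    FreeGroup.lift f (FreeGroup.map some W) = FreeGroup.lift (fun i => f (some i)) W := by
  have : (FreeGroup.lift f).comp (FreeGroup.map some) = FreeGroup.lift (fun i => f (some i)) := by
    ext i; simp
  exact DFunLike.congr_fun this W

theorem backward {n : ℕ} (t : RackTerm (XY n)) (W : FreeGroup (Fin n))
    (h : ev t = FreeGroup.map some W * FreeGroup.of none * (FreeGroup.map some W)⁻¹) :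
    IsQndIsotropy n t := by
  refine ⟨?_, ?_⟩
  · obtain ⟨s, hs⟩ := Quotient.exists_rep
      (rho (XY n) (FreeGroup.map some W)⁻¹ (cl (gen none)))
    have hs' := ev_of_rep (t := s) hs
    have key : ∀ (r : RackTerm (XY n)), FreeGroup.lift
        (fun x => ev (if x = none then r else gen x)) (FreeGroup.map some W)
          = FreeGroup.map some W := by
      intro r
      rw [lift_map_some, FreeGroup.map_eq_lift]
      rfl
    refine ⟨s, ?_, ?_⟩
    · rw [rel_iff, RackTerm.subst, ev_bind, h]
      simp only [map_mul, map_inv, key, FreeGroup.lift_apply_of, if_true, hs', ev]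
      group
    · rw [rel_iff, RackTerm.subst, ev_bind, hs']
      simp only [map_mul, map_inv, key, FreeGroup.lift_apply_of, if_true, h, ev]
      group
  · intro ε
    have key : ∀ r, FreeGroup.lift (fun x => ev (genMap n r x)) (FreeGroup.map some W)
          = FreeGroup.map Sum.inr W := by
      intro r
      rw [lift_map_some, FreeGroup.map_eq_lift]
      rfl
    rw [rel_iff]
    cases ε
    all_goals
      simp only [triE, ev_bind, ev, h, map_mul, map_inv, key, FreeGroup.lift_apply_of,
        if_true, Bool.false_eq_true, if_false]
      simp only [genMap, Option.elim_none, ev]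
      group

theorem forward {n : ℕ} (t : RackTerm (XY n)) (ht : IsQndIsotropy n t) :
    ∃ W : FreeGroup (Fin n),
      ev t = FreeGroup.map some W * FreeGroup.of none * (FreeGroup.map some W)⁻¹ := by
  obtain ⟨⟨s, hs, -⟩, h2⟩ := ht
  obtain ⟨g, z, hg⟩ := exists_rep t
  have hev := ev_of_rep hg
  cases z with
  | some i =>
    exfalso
    rw [rel_iff, RackTerm.subst, ev_bind, hev] at hs
    simp only [map_mul, map_inv, FreeGroup.lift_apply_of] at hs
    have : (some i : XY n) = none := by
      refine conj_gen (h := 1) (hs.trans ?_)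
      simp [ev]
    cases this
  | none =>
    have h := ev_rel (h2 true)
    set a0 : FreeGroup (XXY n) := FreeGroup.of (Sum.inl false) with ha0
    set a1 : FreeGroup (XXY n) := FreeGroup.of (Sum.inl true) with ha1
    let σ : RackTerm (XXY n) → FreeGroup (XY n) →* FreeGroup (XXY n) :=
      fun r => FreeGroup.lift (fun x => ev (genMap n r x))
    have hσ : ∀ r, ev (t.bind (genMap n r)) = σ r g * ev r * (σ r g)⁻¹ := by
      intro r
      rw [ev_bind, hev]
      simp only [map_mul, map_inv, FreeGroup.lift_apply_of]
      rfl
    simp only [triE, if_true, ev, hσ] at h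
    rw [← ha0, ← ha1] at h
    set r01 : RackTerm (XXY n) := (gen (Sum.inl false)).tri (gen (Sum.inl true))
    set r0 : RackTerm (XXY n) := gen (Sum.inl false)
    set r1 : RackTerm (XXY n) := gen (Sum.inl true)
    obtain ⟨k, hk⟩ := centralizer (Sum.inl false)
      ((σ r0 g)⁻¹ * σ r1 g * a1⁻¹ * (σ r1 g)⁻¹ * σ r01 g * a1) (by
        rw [← ha0]
        calc _ = (σ r0 g)⁻¹ * σ r1 g * a1⁻¹ * (σ r1 g)⁻¹ *
              (σ r01 g * (a1 * a0 * a1⁻¹) * (σ r01 g)⁻¹) * (σ r01 g * a1) := by group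
          _ = _ := by rw [h]; group)
    let π : FreeGroup (XXY n) →* FreeGroup (XY n) :=
      FreeGroup.lift (Sum.elim (fun b => if b then FreeGroup.of none else 1)
        (fun i => FreeGroup.of (some i)))
    let e : FreeGroup (XY n) →* FreeGroup (Fin n) :=
      FreeGroup.lift (fun a => a.elim 1 FreeGroup.of)
    have p0 : π.comp (σ r0) = (FreeGroup.map some).comp e := by
      ext i; cases i <;> simp [π, σ, e, genMap, ev, r0]
    have p01 : π.comp (σ r01) = (FreeGroup.map some).comp e := by
      ext i; cases i <;> simp [π, σ, e, genMap, ev, r01, r0, r1]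
    have p1 : π.comp (σ r1) = MonoidHom.id _ := by
      ext i; cases i <;> simp [π, σ, genMap, ev, r1]
    have q0 : π (σ r0 g) = FreeGroup.map some (e g) := DFunLike.congr_fun p0 g
    have q01 : π (σ r01 g) = FreeGroup.map some (e g) := DFunLike.congr_fun p01 g
    have q1 : π (σ r1 g) = g := DFunLike.congr_fun p1 g
    have b1 : π a1 = FreeGroup.of none := by simp [π, a1]
    have b0 : π (FreeGroup.of (Sum.inl false)) = 1 := by simp [π]
    have hπ := congrArg π hk
    simp only [map_mul, map_inv, map_zpow, q0, q01, q1, b1, b0, one_zpow] at hπ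
    refine ⟨e g, ?_⟩
    rw [hev]
    generalize FreeGroup.map some (e g) = w at hπ ⊢
    generalize (FreeGroup.of none : FreeGroup (XY n)) = x at hπ ⊢
    have h3 : g * x⁻¹ * g⁻¹ = w * x⁻¹ * w⁻¹ := by
      calc g * x⁻¹ * g⁻¹ = w * (w⁻¹ * g * x⁻¹ * g⁻¹ * w * x) * x⁻¹ * w⁻¹ := by group
        _ = _ := by rw [hπ]; group
    have h4 := congrArg (·⁻¹) h3
    simpa [mul_assoc] using h4

end FQ

/-- **Isotropy group of a free quandle** (Theorem 2 of the paper).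
For any rack term `t` over `{x, y₁, …, yₙ}`, the class `[t]` belongs to
`G_Qnd(n)` iff there are `m ≥ 0`, indices `i₁, …, iₘ` and signs `ε₁, …, εₘ`
(i.e. a word `w` over `{y₁, …, yₙ}`) such that
`t ~Q x ◁^{ε₁} y_{i₁} ◁^{ε₂} ⋯ ◁^{εₘ} y_{iₘ}` (left-associated) and the group
word `y_{i₁}^{ε₁} ⋯ y_{iₘ}^{εₘ}` is reduced. -/
theorem free_quandle_isotropy (n : ℕ) (t : RackTerm (XY n)) :
    IsQndIsotropy n t ↔
      ∃ w : List (Fin n × Bool), ReducedWord w ∧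
        QndRel (XY n) t
          ((RackTerm.gen none).chain
            (w.map fun p => ((some p.1 : XY n), p.2))) := by
  constructor
  · intro ht
    obtain ⟨W, hW⟩ := FQ.forward t ht
    refine ⟨W.toWord.reverse, FQ.reduced_reverse FreeGroup.isReduced_toWord, ?_⟩
    rw [FQ.rel_iff, FQ.ev_chain_some, FreeGroup.mk_toWord, hW]
  · rintro ⟨w, -, h⟩
    refine FQ.backward t (FreeGroup.mk w.reverse) ?_
    rw [FQ.ev_rel h, ← FQ.ev_chain_some, List.reverse_reverse]
end

section
/- The isotropy group of the free quandle on n generators is isomorphic, as a group, to the free group on n generators: G_Qnd(n) ≅ FreeGroup (Fin n), where G_Qnd(n) carries the multiplication [s]·[t] = [s[t/x]] with unit [x]. -/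
/-- The setoid of rack terms over `{x, y₁, …, yₙ}` modulo the quandle
congruence `~Q`. -/
def qndSetoid (n : ℕ) : Setoid (RackTerm (XY n)) :=
  ⟨QndRel (XY n), ⟨QndRel.refl, QndRel.symm, QndRel.trans⟩⟩

/-- The carrier of the logical isotropy group `G_Qnd(n)`: the set of
`~Q`-classes `[t]` of terms `t` over `{x, y₁, …, yₙ}` that are invertible and
commute generically with `◁` and `◁⁻¹`. -/
def GQnd (n : ℕ) : Type :=
  {a : Quotient (qndSetoid n) //
    ∃ t : RackTerm (XY n), a = Quotient.mk (qndSetoid n) t ∧ IsQndIsotropy n t}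

/-- The element `[t]` of `G_Qnd(n)` determined by a term `t` satisfying the
isotropy conditions. -/
def GQnd.mk (n : ℕ) (t : RackTerm (XY n)) (h : IsQndIsotropy n t) : GQnd n :=
  ⟨Quotient.mk (qndSetoid n) t, t, rfl, h⟩

namespace QIso

theorem comm_of {X : Type} [DecidableEq X] (x : X) :
    ∀ (N : ℕ) (g : FreeGroup X), g.norm = N →
      FreeGroup.of x * g = g * FreeGroup.of x → ∃ k : ℤ, g = FreeGroup.of x ^ k := by
  intro N
  induction N using Nat.strong_induction_on with
  | _ N ih =>
  intro g hN hc
  rcases hL : g.toWord with _ | ⟨⟨a, b⟩, L⟩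
  · exact ⟨0, by simpa using hL⟩
  · have hg : g = FreeGroup.mk ((a, b) :: L) := by rw [← hL, FreeGroup.mk_toWord]
    have hred : FreeGroup.reduce ((a, b) :: L) = (a, b) :: L := by
      rw [← hL, FreeGroup.reduce_toWord]
    by_cases hax : a = x
    · subst hax
      have hg' : g = FreeGroup.mk [(a, b)] * FreeGroup.mk L := by
        rw [hg, FreeGroup.mul_mk]; rfl
      have hm : ∃ m : ℤ, FreeGroup.mk [(a, b)] = FreeGroup.of a ^ m := by
        cases b
        · exact ⟨-1, by rw [zpow_neg_one]; simp [FreeGroup.of, FreeGroup.inv_mk, FreeGroup.invRev]⟩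
        · exact ⟨1, by rw [zpow_one]; rfl⟩
      obtain ⟨m, hm⟩ := hm
      rw [hm] at hg'
      have hlt : (FreeGroup.mk L).norm < N := by
        have h1 : (FreeGroup.mk L).norm ≤ L.length := FreeGroup.norm_mk_le
        have h2 : g.norm = L.length + 1 := by simp [FreeGroup.norm, hL]
        omega
      obtain ⟨k, hk⟩ := ih _ hlt (FreeGroup.mk L) rfl (by
        have e : FreeGroup.mk L = FreeGroup.of a ^ (-m) * g := by rw [hg']; group
        have hcm : Commute (FreeGroup.of a) g := hc
        rw [e]
        exact ((Commute.refl (FreeGroup.of a)).zpow_right (-m)).mul_right hcm)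
      exact ⟨m + k, by rw [hg', hk, zpow_add]⟩
    · exfalso
      have h1 : (FreeGroup.of x * g).toWord = (x, true) :: (a, b) :: L := by
        rw [hg]
        show (FreeGroup.mk [(x, true)] * _).toWord = _
        rw [FreeGroup.mul_mk, FreeGroup.toWord_mk, List.singleton_append, FreeGroup.reduce.cons,
          hred]
        simp [Ne.symm hax]
      have h2 := FreeGroup.toWord_mul_sublist g (FreeGroup.of x)
      rw [← hc, h1, hL, FreeGroup.toWord_of] at h2
      have h3 := h2.eq_of_length (by simp)
      simp at h3
      exact hax h3.1.1.symm

theorem commute_of {X : Type} (x : X) (g : FreeGroup X)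
    (h : FreeGroup.of x * g = g * FreeGroup.of x) : ∃ k : ℤ, g = FreeGroup.of x ^ k := by
  classical
  exact comm_of x _ g rfl h

/-- Evaluation in the conjugation quandle of the free group. -/
def ev {X : Type} : RackTerm X → FreeGroup X
  | .gen x => FreeGroup.of x
  | .tri a b => (ev b)⁻¹ * ev a * ev b
  | .triInv a b => ev b * ev a * (ev b)⁻¹

/-- The conjugating element. -/
def cj {X : Type} : RackTerm X → FreeGroup X
  | .gen _ => 1
  | .tri a b => (ev b)⁻¹ * cj a
  | .triInv a b => ev b * cj a

theorem ev_eq {X : Type} (t : RackTerm X) :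
    ev t = cj t * FreeGroup.of t.left * (cj t)⁻¹ := by
  induction t with
  | gen x => simp [ev, cj, RackTerm.left]
  | tri a b iha ihb => simp only [ev, cj, RackTerm.left]; rw [iha]; group
  | triInv a b iha ihb => simp only [ev, cj, RackTerm.left]; rw [iha]; group

theorem ev_sound {X : Type} {s t : RackTerm X} (h : QndRel X s t) : ev s = ev t := by
  induction h with
  | refl a => rfl
  | symm _ ih => exact ih.symm
  | trans _ _ ih1 ih2 => exact ih1.trans ih2
  | congr_tri _ _ ih1 ih2 => simp only [ev, ih1, ih2]
  | congr_triInv _ _ ih1 ih2 => simp only [ev, ih1, ih2]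
  | self_distrib a b c => simp only [ev]; group
  | self_distrib_inv a b c => simp only [ev]; group
  | cancel a b => simp only [ev]; group
  | cancel_inv a b => simp only [ev]; group
  | idem a => simp only [ev]; group
  | idem_inv a => simp only [ev]; group

theorem left_sound {X : Type} {s t : RackTerm X} (h : QndRel X s t) : s.left = t.left := by
  induction h <;> simp_all [RackTerm.left]

theorem left_bind {X Y : Type} (t : RackTerm X) (f : X → RackTerm Y) :
    (t.bind f).left = (f t.left).left := by
  induction t <;> simp_all [RackTerm.left, RackTerm.bind]

theorem ev_bind {X Y : Type} (t : RackTerm X) (f : X → RackTerm Y) :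
    ev (t.bind f) = FreeGroup.lift (fun a => ev (f a)) (ev t) := by
  induction t <;> simp_all [ev, RackTerm.bind]

/-- The quandle setoid. -/
def st (X : Type) : Setoid (RackTerm X) :=
  ⟨QndRel X, ⟨QndRel.refl, QndRel.symm, QndRel.trans⟩⟩

/-- The free quandle. -/
abbrev Q (X : Type) : Type := Quotient (st X)

/-- The class of a term. -/
abbrev cl {X : Type} (t : RackTerm X) : Q X := Quotient.mk (st X) t

theorem cl_eq {X : Type} {s t : RackTerm X} : cl s = cl t ↔ QndRel X s t :=
  ⟨fun h => Quotient.exact h, fun h => Quotient.sound h⟩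

/-- Right translation by the inverse operation. -/
def tr {X : Type} (b : RackTerm X) : Equiv.Perm (Q X) where
  toFun := Quotient.map (sa := st X) (sb := st X) (fun a => a.triInv b)
    (fun _ _ h => QndRel.congr_triInv h (QndRel.refl b))
  invFun := Quotient.map (sa := st X) (sb := st X) (fun a => a.tri b)
    (fun _ _ h => QndRel.congr_tri h (QndRel.refl b))
  left_inv := by
    intro q
    induction q using Quotient.inductionOn with
    | h a => exact cl_eq.2 (QndRel.cancel_inv a b)
  right_inv := by
    intro q
    induction q using Quotient.inductionOn with
    | h a => exact cl_eq.2 (QndRel.cancel a b)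

theorem tr_cl {X : Type} (a b : RackTerm X) : tr b (cl a) = cl (a.triInv b) := rfl

theorem tr_inv_cl {X : Type} (a b : RackTerm X) : (tr b)⁻¹ (cl a) = cl (a.tri b) := rfl

theorem tr_tri {X : Type} (b c : RackTerm X) : tr (b.tri c) = (tr c)⁻¹ * tr b * tr c := by
  have : (tr c)⁻¹ * (tr b)⁻¹ = (tr (b.tri c))⁻¹ * (tr c)⁻¹ := by
    ext q
    induction q using Quotient.inductionOn with
    | h a => exact cl_eq.2 (QndRel.self_distrib a b c)
  have h2 : (tr (b.tri c))⁻¹ = (tr c)⁻¹ * (tr b)⁻¹ * tr c := by rw [this]; group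
  rw [← inv_inj, h2]; group

theorem tr_triInv {X : Type} (b c : RackTerm X) : tr (b.triInv c) = tr c * tr b * (tr c)⁻¹ := by
  have : tr c * tr b = tr (b.triInv c) * tr c := by
    ext q
    induction q using Quotient.inductionOn with
    | h a => exact cl_eq.2 (QndRel.self_distrib_inv a b c)
  rw [this]; group

/-- The action of the free group on the free quandle. -/
def ρ (X : Type) : FreeGroup X →* Equiv.Perm (Q X) := FreeGroup.lift (fun x => tr (.gen x))

theorem ρ_ev {X : Type} (t : RackTerm X) : ρ X (ev t) = tr t := by
  induction t with
  | gen x => simp [ρ, ev]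
  | tri a b iha ihb => simp only [ev, map_mul, map_inv, iha, ihb, tr_tri]
  | triInv a b iha ihb => simp only [ev, map_mul, map_inv, iha, ihb, tr_triInv]

theorem cl_eq_ρ {X : Type} (t : RackTerm X) : cl t = ρ X (cj t) (cl (.gen t.left)) := by
  induction t with
  | gen x => simp [cj, RackTerm.left]
  | tri a b iha ihb =>
    simp only [cj, map_mul, map_inv, ρ_ev, RackTerm.left, Equiv.Perm.mul_apply]
    rw [← iha, tr_inv_cl]
  | triInv a b iha ihb =>
    simp only [cj, map_mul, ρ_ev, RackTerm.left, Equiv.Perm.mul_apply]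
    rw [← iha, tr_cl]

/-- Evaluation on the quotient. -/
def evQ {X : Type} : Q X → FreeGroup X := Quotient.lift ev (fun _ _ h => ev_sound h)

theorem evQ_cl {X : Type} (t : RackTerm X) : evQ (cl t) = ev t := rfl

theorem evQ_ρ {X : Type} (g : FreeGroup X) : ∀ q : Q X, evQ (ρ X g q) = g * evQ q * g⁻¹ := by
  have key : ∀ (x : X) (q : Q X),
      evQ (ρ X (FreeGroup.of x) q) = FreeGroup.of x * evQ q * (FreeGroup.of x)⁻¹ := by
    intro x q
    induction q using Quotient.inductionOn with
    | h a => simp only [ρ, FreeGroup.lift_apply_of]; rfl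
  induction g using FreeGroup.induction_on with
  | C1 => simp
  | of x => exact key x
  | inv_of x _ =>
    intro q
    have := key x ((ρ X (FreeGroup.of x))⁻¹ q)
    rw [← Equiv.Perm.mul_apply, mul_inv_cancel, Equiv.Perm.one_apply] at this
    rw [this, map_inv]; group
  | mul a b iha ihb =>
    intro q
    rw [map_mul, Equiv.Perm.mul_apply, iha, ihb]; group

theorem conj_eq {X : Type} {x : X} {g h : FreeGroup X}
    (e : g * FreeGroup.of x * g⁻¹ = h * FreeGroup.of x * h⁻¹) :
    ∃ k : ℤ, g = h * FreeGroup.of x ^ k := by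
  obtain ⟨k, hk⟩ := commute_of x (h⁻¹ * g) (by
    have : FreeGroup.of x * (h⁻¹ * g) = h⁻¹ * (h * FreeGroup.of x * h⁻¹) * g := by group
    rw [this, ← e]; group)
  exact ⟨k, by rw [← hk]; group⟩

theorem ρ_zpow {X : Type} (x : X) (k : ℤ) :
    ρ X (FreeGroup.of x ^ k) (cl (.gen x)) = cl (.gen x) := by
  have h : ρ X (FreeGroup.of x) (cl (.gen x)) = cl (.gen x) := by
    simp only [ρ, FreeGroup.lift_apply_of]
    exact cl_eq.2 (QndRel.idem_inv _)
  rw [map_zpow]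
  exact Function.IsFixedPt.perm_zpow h k

theorem complete {X : Type} {s t : RackTerm X} (h : ev s = ev t) : QndRel X s t := by
  rw [← cl_eq, cl_eq_ρ s, cl_eq_ρ t]
  have hl : s.left = t.left := by
    classical
    rw [ev_eq s, ev_eq t] at h
    have := congrArg (FreeGroup.lift
      (fun y => if y = t.left then Multiplicative.ofAdd (1 : ℤ) else 1)) h
    simp only [map_mul, map_inv, FreeGroup.lift_apply_of, mul_inv_cancel_comm] at this
    by_contra hne
    rw [if_neg hne, if_pos trivial] at this
    exact absurd this (by decide)
  rw [ev_eq s, ev_eq t, hl] at h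
  obtain ⟨k, hk⟩ := conj_eq h
  rw [hl, hk, map_mul, Equiv.Perm.mul_apply, ρ_zpow]

/-- Inclusion of the `y`s. -/
def j (n : ℕ) : FreeGroup (Fin n) →* FreeGroup (XY n) := FreeGroup.map some

/-- Killing `x`. -/
def p (n : ℕ) : FreeGroup (XY n) →* FreeGroup (Fin n) :=
  FreeGroup.lift (fun a => a.elim 1 FreeGroup.of)

theorem p_j {n : ℕ} (g : FreeGroup (Fin n)) : p n (j n g) = g := by
  have : (p n).comp (j n) = MonoidHom.id _ := by
    ext i; simp [p, j]
  exact DFunLike.congr_fun this g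

/-- The property characterising the term attached to `g`. -/
def Rep {n : ℕ} (g : FreeGroup (Fin n)) (t : RackTerm (XY n)) : Prop :=
  ev t = j n g * FreeGroup.of none * (j n g)⁻¹

theorem exists_rep {n : ℕ} (g : FreeGroup (Fin n)) : ∃ t : RackTerm (XY n), Rep g t := by
  obtain ⟨t, ht⟩ := Quotient.exists_rep (ρ (XY n) (j n g) (cl (.gen none)))
  refine ⟨t, ?_⟩
  have := evQ_ρ (j n g) (cl (.gen none))
  rw [← ht] at this
  exact this

theorem ev_subst {n : ℕ} {g : FreeGroup (Fin n)} {s t : RackTerm (XY n)} (hs : Rep g s) :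
    ev (s.subst none t) = j n g * ev t * (j n g)⁻¹ := by
  rw [RackTerm.subst, ev_bind, hs]
  have : (FreeGroup.lift (fun a : XY n => ev (if a = none then t else .gen a))).comp (j n)
      = j n := by
    ext i; simp [j, ev]
  have h2 := DFunLike.congr_fun this g
  simp only [MonoidHom.comp_apply] at h2
  simp [h2]

theorem rep_subst {n : ℕ} {g h : FreeGroup (Fin n)} {s t : RackTerm (XY n)}
    (hs : Rep g s) (ht : Rep h t) : Rep (g * h) (s.subst none t) := by
  rw [Rep, ev_subst hs, ht, map_mul]; group

theorem rep_one {n : ℕ} {t : RackTerm (XY n)} : Rep 1 t ↔ ev t = ev (.gen none) := by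
  simp [Rep, ev]

/-- Inclusion of the `y`s in the larger group. -/
def jj (n : ℕ) : FreeGroup (Fin n) →* FreeGroup (XXY n) := FreeGroup.map Sum.inr

/-- The homomorphism of a substitution. -/
def hh (n : ℕ) (s : RackTerm (XXY n)) : FreeGroup (XY n) →* FreeGroup (XXY n) :=
  FreeGroup.lift (fun a => ev (genMap n s a))

theorem hh_none {n : ℕ} (s : RackTerm (XXY n)) : hh n s (FreeGroup.of none) = ev s := by
  simp [hh, genMap]

theorem hh_j {n : ℕ} (s : RackTerm (XXY n)) (g : FreeGroup (Fin n)) :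
    hh n s (j n g) = jj n g := by
  have : (hh n s).comp (j n) = jj n := by
    ext i; simp [j, jj, hh, genMap, ev]
  exact DFunLike.congr_fun this g

theorem ev_genMap {n : ℕ} (t : RackTerm (XY n)) (s : RackTerm (XXY n)) :
    ev (t.bind (genMap n s)) = hh n s (ev t) := ev_bind _ _

theorem iso_of_rep {n : ℕ} {g : FreeGroup (Fin n)} {t : RackTerm (XY n)} (ht : Rep g t) :
    IsQndIsotropy n t := by
  refine ⟨?_, ?_⟩
  · obtain ⟨u, hu⟩ := exists_rep (g⁻¹)
    refine ⟨u, complete ?_, complete ?_⟩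
    · rw [← rep_one]; simpa using rep_subst ht hu
    · rw [← rep_one]; simpa using rep_subst hu ht
  · have e : ∀ s : RackTerm (XXY n),
        ev (t.bind (genMap n s)) = jj n g * ev s * (jj n g)⁻¹ := by
      intro s
      rw [ev_genMap, ht]; simp only [map_mul, map_inv, hh_j, hh_none]
    intro ε
    apply complete
    cases ε <;> simp only [RackTerm.triE, if_true, Bool.false_eq_true, if_false, ev, e] <;> group

/-- Killing `x₀`. -/
def q (n : ℕ) : FreeGroup (XXY n) →* FreeGroup (XY n) :=
  FreeGroup.lift (Sum.elim (fun b => if b then FreeGroup.of none else 1)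
    (fun i => FreeGroup.of (some i)))

theorem q_kill {n : ℕ} (s : RackTerm (XXY n)) (hs : q n (ev s) = 1) (v : FreeGroup (XY n)) :
    q n (hh n s v) = j n (p n v) := by
  have : (q n).comp (hh n s) = (j n).comp (p n) := by
    ext a
    cases a with
    | none => simp [hh_none, hs, p]
    | some i => simp [hh, genMap, ev, q, p, j]
  exact DFunLike.congr_fun this v

theorem q_id {n : ℕ} (v : FreeGroup (XY n)) :
    q n (hh n (.gen (.inl true)) v) = v := by
  have : (q n).comp (hh n (.gen (.inl true))) = MonoidHom.id _ := by
    ext a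
    cases a with
    | none => simp [hh_none, ev, q]
    | some i => simp [hh, genMap, ev, q]
  exact DFunLike.congr_fun this v

theorem rep_of_iso {n : ℕ} {t : RackTerm (XY n)} (ht : IsQndIsotropy n t) :
    ∃ g : FreeGroup (Fin n), Rep g t := by
  obtain ⟨⟨u, hu, -⟩, hc⟩ := ht
  have hl : t.left = none := by
    have h := left_sound hu
    rw [RackTerm.subst, left_bind] at h
    by_contra hne
    rw [if_neg hne] at h
    exact hne h
  have hev := ev_eq t
  rw [hl] at hev
  have h := ev_sound (hc true)
  simp only [RackTerm.triE, if_true] at h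
  have hx : ev ((RackTerm.gen (Sum.inl false : XXY n)).tri (.gen (.inl true)))
    = (FreeGroup.of (Sum.inl true))⁻¹ * FreeGroup.of (Sum.inl false) *
      FreeGroup.of (Sum.inl true) := rfl
  have k0 := q_kill (n := n) (.gen (.inl false)) (by simp [ev, q]) (cj t)
  have k01 := q_kill (n := n) ((RackTerm.gen (.inl false)).tri (.gen (.inl true)))
    (by simp [ev, q]) (cj t)
  have k1 := q_id (n := n) (cj t)
  simp only [ev_genMap, ev, hev, map_mul, map_inv, hh_none] at h
  generalize hh n (.gen (.inl false)) (cj t) = v0 at *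
  generalize hh n ((RackTerm.gen (.inl false)).tri (.gen (.inl true))) (cj t) = v01 at *
  generalize hh n (.gen (.inl true)) (cj t) = v1 at *
  obtain ⟨k, hk⟩ := conj_eq (x := (Sum.inl false : XXY n))
    (g := v01 * (FreeGroup.of (Sum.inl true))⁻¹)
    (h := (v1 * FreeGroup.of (Sum.inl true) * v1⁻¹)⁻¹ * v0) (by
      simp only [mul_inv_rev, inv_inv, mul_assoc] at h ⊢
      exact h)
  have hk2 := congrArg (q n) hk
  have q0 : q n (FreeGroup.of (Sum.inl false)) = 1 := by simp [q]
  have q1 : q n (FreeGroup.of (Sum.inl true)) = FreeGroup.of none := by simp [q]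
  simp only [map_mul, map_inv, map_zpow, k0, k01, k1, q0, q1, one_zpow, mul_one] at hk2
  refine ⟨p n (cj t), ?_⟩
  rw [Rep, hev]
  generalize j n (p n (cj t)) = w at *
  generalize cj t = v at *
  have h3 : v * FreeGroup.of none * v⁻¹ = w * (w * (FreeGroup.of none)⁻¹)⁻¹ := by
    rw [hk2]; group
  rw [h3]; group

theorem rep_inj {n : ℕ} {g h : FreeGroup (Fin n)} {t : RackTerm (XY n)}
    (hg : Rep g t) (hh : Rep h t) : g = h := by
  obtain ⟨k, hk⟩ := conj_eq (hg.symm.trans hh)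
  have := congrArg (p n) hk
  have p0 : p n (FreeGroup.of none) = 1 := by simp [p]
  simpa [p_j, p0] using this

end QIso

/-- **The isotropy group of the free quandle on `n` generators is the free
group on `n` generators** (Corollary 1 of the paper): there is a bijection
`G_Qnd(n) ≃ FreeGroup (Fin n)` carrying the unit `[x]` to `1` and the
multiplication `[s]·[t] = [s[t/x]]` of `G_Qnd(n)` to the multiplication of the
free group; i.e. a group isomorphism `G_Qnd(n) ≅ FreeGroup (Fin n)`. -/
theorem free_quandle_isotropy_iso_freeGroup (n : ℕ) :
    ∃ e : GQnd n ≃ FreeGroup (Fin n),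
      (∀ hu : IsQndIsotropy n (.gen none), e (GQnd.mk n (.gen none) hu) = 1) ∧
      (∀ (s t : RackTerm (XY n)) (hs : IsQndIsotropy n s) (ht : IsQndIsotropy n t)
        (hst : IsQndIsotropy n (s.subst none t)),
        e (GQnd.mk n (s.subst none t) hst) = e (GQnd.mk n s hs) * e (GQnd.mk n t ht)) := by
  choose r hr using fun g : FreeGroup (Fin n) => QIso.exists_rep g
  have hmk : ∀ (g : FreeGroup (Fin n)) (t : RackTerm (XY n)) (ht : IsQndIsotropy n t),
      QIso.Rep g t → GQnd.mk n (r g) (QIso.iso_of_rep (hr g)) = GQnd.mk n t ht := by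
    intro g t ht hg
    apply Subtype.ext
    exact Quotient.sound (QIso.complete ((hr g).trans hg.symm))
  have hbij : Function.Bijective
      (fun g : FreeGroup (Fin n) => GQnd.mk n (r g) (QIso.iso_of_rep (hr g))) := by
    constructor
    · intro g h e
      have e1 : QndRel (XY n) (r g) (r h) := Quotient.exact (congrArg Subtype.val e)
      exact QIso.rep_inj (hr g) ((QIso.ev_sound e1).trans (hr h))
    · rintro ⟨a, t, rfl, ht⟩
      obtain ⟨g, hg⟩ := QIso.rep_of_iso ht
      exact ⟨g, hmk g t ht hg⟩
  have hval : ∀ (g : FreeGroup (Fin n)) (t : RackTerm (XY n)) (ht : IsQndIsotropy n t),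
      QIso.Rep g t → (Equiv.ofBijective _ hbij).symm (GQnd.mk n t ht) = g := by
    intro g t ht hg
    rw [Equiv.symm_apply_eq]
    exact (hmk g t ht hg).symm
  refine ⟨(Equiv.ofBijective _ hbij).symm, ?_, ?_⟩
  · intro hu
    exact hval 1 _ hu (QIso.rep_one.2 rfl)
  · intro s t hs ht hst
    obtain ⟨g, hg⟩ := QIso.rep_of_iso hs
    obtain ⟨h, hh⟩ := QIso.rep_of_iso ht
    rw [hval g s hs hg, hval h t ht hh]
    exact hval _ _ hst (QIso.rep_subst hg hh)
end

section
/- Characterization of the isotropy group of the free rack on n generators: for any rack term t over the generator set {x, y_1, …, y_n}, the class [t] belongs to G_Rck(n) if and only if there exist p, m ≥ 0, signs δ_1, …, δ_p, ε_1, …, ε_m ∈ {1, −1} and indices i_1, …, i_m ∈ {1, …, n} such that t ~R x ◁^{δ_1} x ◁^{δ_2} … ◁^{δ_p} x ◁^{ε_1} y_{i_1} ◁^{ε_2} … ◁^{ε_m} y_{i_m} (left-associated) and the group word x^{δ_1} ⋯ x^{δ_p} y_{i_1}^{ε_1} ⋯ y_{i_m}^{ε_m} over {x, y_1, …, y_n}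 is reduced (equivalently, δ_1 = δ_2 = … = δ_p and the word y_{i_1}^{ε_1} ⋯ y_{i_m}^{ε_m} is reduced). -/
/-- The smallest congruence `~R` on rack terms over `X`, compatible with `◁`
and `◁⁻¹`, containing all instances of the rack axioms (self-distributivity of
`◁` and of `◁⁻¹`, and the two cancellation laws `(a ◁ b) ◁⁻¹ b = a` and
`(a ◁⁻¹ b) ◁ b = a`). -/
inductive RackRel (X : Type) : RackTerm X → RackTerm X → Prop
  | refl (a : RackTerm X) : RackRel X a a
  | symm {a b : RackTerm X} : RackRel X a b → RackRel X b a
  | trans {a b c : RackTerm X} : RackRel X a b → RackRel X b c → RackRel X a c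
  | congr_tri {a a' b b' : RackTerm X} : RackRel X a a' → RackRel X b b' →
      RackRel X (a.tri b) (a'.tri b')
  | congr_triInv {a a' b b' : RackTerm X} : RackRel X a a' → RackRel X b b' →
      RackRel X (a.triInv b) (a'.triInv b')
  | self_distrib (a b c : RackTerm X) : RackRel X ((a.tri b).tri c) ((a.tri c).tri (b.tri c))
  | self_distrib_inv (a b c : RackTerm X) :
      RackRel X ((a.triInv b).triInv c) ((a.triInv c).triInv (b.triInv c))
  | cancel (a b : RackTerm X) : RackRel X ((a.tri b).triInv b) a
  | cancel_inv (a b : RackTerm X) : RackRel X ((a.triInv b).tri b) a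

/-- The membership predicate for the logical isotropy group `G_Rck(n)` of the
free rack on `n` generators: `[t] ∈ G_Rck(n)` iff (i) `[t]` is invertible,
i.e. there is `t⁻¹` with `t[t⁻¹/x] ~R x ~R t⁻¹[t/x]`, and (ii) `[t]` commutes
generically with `◁` and `◁⁻¹`, i.e.
`t[(x₀ ◁^ε x₁)/x] ~R t[x₀/x] ◁^ε t[x₁/x]` for `ε = ±1`. -/
def IsRckIsotropy (n : ℕ) (t : RackTerm (XY n)) : Prop :=
  (∃ tinv : RackTerm (XY n),
      RackRel (XY n) (t.subst none tinv) (.gen none) ∧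
      RackRel (XY n) (tinv.subst none t) (.gen none)) ∧
  (∀ ε : Bool,
      RackRel (XXY n)
        (t.bind (genMap n ((RackTerm.gen (.inl false)).triE ε (.gen (.inl true)))))
        ((t.bind (genMap n (.gen (.inl false)))).triE ε
          (t.bind (genMap n (.gen (.inl true))))))

namespace RackAux

open RackTerm

theorem congrE {X : Type} {a a' b b' : RackTerm X} (e : Bool) (h : RackRel X a a')
    (h' : RackRel X b b') : RackRel X (a.triE e b) (a'.triE e b') := by
  cases e
  · exact .congr_triInv h h'
  · exact .congr_tri h h'

theorem cancelE {X : Type} (a b : RackTerm X) (e : Bool) :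
    RackRel X ((a.triE e b).triE (!e) b) a := by
  cases e
  · exact .cancel_inv a b
  · exact .cancel a b

theorem cancelE2 {X : Type} (a b : RackTerm X) (e : Bool) :
    RackRel X ((a.triE (!e) b).triE e b) a := by
  cases e
  · exact .cancel a b
  · exact .cancel_inv a b

theorem distribSame {X : Type} (a b c : RackTerm X) (e : Bool) :
    RackRel X ((a.triE e b).triE e c) ((a.triE e c).triE e (b.triE e c)) := by
  cases e
  · exact .self_distrib_inv a b c
  · exact .self_distrib a b c

theorem distribE {X : Type} (a b c : RackTerm X) (e d : Bool) :
    RackRel X ((a.triE e b).triE d c) ((a.triE d c).triE e (b.triE d c)) := by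
  by_cases h : e = d
  · subst h; exact distribSame a b c e
  · obtain rfl : e = !d := by cases e <;> cases d <;> simp_all
    have h1 : RackRel X (((a.triE (!d) b).triE d c).triE d (b.triE d c)) (a.triE d c) :=
      (distribSame _ b c d).symm.trans (congrE d (cancelE2 a b d) (.refl c))
    exact (cancelE _ (b.triE d c) d).symm.trans (congrE (!d) h1 (.refl _))

/-- `a ◁^e (b ◁^d c) = ((a ◁^{-d} c) ◁^e b) ◁^d c`. -/
theorem triE_triE {X : Type} (a b c : RackTerm X) (e d : Bool) :
    RackRel X (a.triE e (b.triE d c)) (((a.triE (!d) c).triE e b).triE d c) :=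
  (congrE e (cancelE2 a c d).symm (.refl _)).trans (distribE _ b c e d).symm

theorem chain_congr {X : Type} (L : List (X × Bool)) : ∀ {a b : RackTerm X}, RackRel X a b →
    RackRel X (a.chain L) (b.chain L) := by
  induction L with
  | nil => intro a b h; exact h
  | cons p L ih => intro a b h; exact ih (congrE _ h (.refl _))

theorem chain_append {X : Type} (L M : List (X × Bool)) : ∀ a : RackTerm X,
    a.chain (L ++ M) = (a.chain L).chain M := by
  induction L with
  | nil => intro a; rfl
  | cons p L ih => intro a; exact ih _

theorem chain_red {X : Type} {L M : List (X × Bool)} (h : FreeGroup.Red L M) (a : RackTerm X) :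
    RackRel X (a.chain L) (a.chain M) := by
  induction h with
  | refl => exact .refl _
  | tail _ hs ih =>
    refine ih.trans ?_
    cases hs with
    | not =>
      rw [chain_append, chain_append]
      exact chain_congr _ (cancelE _ _ _)

theorem triE_chain {X : Type} (L : List (X × Bool)) : ∀ (a b : RackTerm X) (e : Bool),
    RackRel X (a.triE e (b.chain L))
      (((a.chain (FreeGroup.invRev L)).triE e b).chain L) := by
  induction L with
  | nil => intro a b e; exact .refl _
  | cons p L ih =>
    intro a b e
    refine (ih a _ e).trans ?_
    rw [FreeGroup.invRev_cons, chain_append]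
    exact chain_congr L (triE_triE _ _ _ _ _)

/-- Interpretation in the free rack `X × F(X)`. -/
def ev {X : Type} : RackTerm X → X × FreeGroup X
  | gen x => (x, 1)
  | tri a b => ((ev a).1, (ev a).2 * ((ev b).2⁻¹ * FreeGroup.of (ev b).1 * (ev b).2))
  | triInv a b => ((ev a).1, (ev a).2 * ((ev b).2⁻¹ * (FreeGroup.of (ev b).1)⁻¹ * (ev b).2))

theorem ev_triE {X : Type} (a b : RackTerm X) (e : Bool) :
    ev (a.triE e b) =
      ((ev a).1, (ev a).2 * ((ev b).2⁻¹ * FreeGroup.mk [((ev b).1, e)] * (ev b).2)) := by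
  cases e
  · rfl
  · rfl

theorem ev_sound {X : Type} {s t : RackTerm X} (h : RackRel X s t) : ev s = ev t := by
  induction h with
  | refl => rfl
  | symm _ ih => exact ih.symm
  | trans _ _ h1 h2 => exact h1.trans h2
  | congr_tri _ _ h1 h2 => simp only [ev, h1, h2]
  | congr_triInv _ _ h1 h2 => simp only [ev, h1, h2]
  | self_distrib a b c => simp only [ev]; congr 1; group
  | self_distrib_inv a b c => simp only [ev]; congr 1; group
  | cancel a b => simp only [ev]; ext1; rfl; simp; group
  | cancel_inv a b => simp only [ev]; ext1; rfl; simp; group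

theorem ev_chain {X : Type} (L : List (X × Bool)) : ∀ a : RackTerm X,
    ev (a.chain L) = ((ev a).1, (ev a).2 * FreeGroup.mk L) := by
  induction L with
  | nil => intro a; ext1; rfl; exact (mul_one _).symm
  | cons p L ih =>
    intro a
    have h : FreeGroup.mk (p :: L) = FreeGroup.mk [p] * FreeGroup.mk L := by
      simp [FreeGroup.mul_mk]
    rw [h]
    simp only [RackTerm.chain, ih, ev_triE, ev]
    simp [mul_assoc]

theorem normal_form {X : Type} [DecidableEq X] (t : RackTerm X) :
    RackRel X t ((gen (ev t).1).chain (ev t).2.toWord) := by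
  have key : ∀ (a b : RackTerm X) (e : Bool),
      RackRel X a ((gen (ev a).1).chain (ev a).2.toWord) →
      RackRel X b ((gen (ev b).1).chain (ev b).2.toWord) →
      RackRel X (a.triE e b) ((gen (ev (a.triE e b)).1).chain (ev (a.triE e b)).2.toWord) := by
    intro a b e ha hb
    refine (congrE e ha hb).trans ((triE_chain _ _ _ e).trans ?_)
    rw [← chain_append]
    change RackRel X ((((gen (ev a).1).chain ((ev a).2.toWord ++
      FreeGroup.invRev (ev b).2.toWord)).chain [((ev b).1, e)]).chain _) _
    rw [← chain_append, ← chain_append, ev_triE]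
    have : (ev a).2 * ((ev b).2⁻¹ * FreeGroup.mk [((ev b).1, e)] * (ev b).2) =
        FreeGroup.mk ((ev a).2.toWord ++ FreeGroup.invRev (ev b).2.toWord ++ [((ev b).1, e)] ++
          (ev b).2.toWord) := by
      simp only [← FreeGroup.mul_mk, ← FreeGroup.inv_mk, FreeGroup.mk_toWord, mul_assoc]
    rw [this, FreeGroup.toWord_mk]
    apply chain_red
    rw [← List.append_assoc]
    apply FreeGroup.reduce.red
  induction t with
  | gen x => exact .refl _
  | tri a b ha hb => exact key a b true ha hb
  | triInv a b ha hb => exact key a b false ha hb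

theorem rel_iff {X : Type} [DecidableEq X] (s t : RackTerm X) : RackRel X s t ↔ ev s = ev t := by
  refine ⟨ev_sound, fun h => (normal_form s).trans ?_⟩
  rw [h]
  exact (normal_form t).symm

/-- The generator conjugated, induced by a substitution. -/
def sub {X Y : Type} (f : X → RackTerm Y) : FreeGroup X →* FreeGroup Y :=
  FreeGroup.lift fun z => (ev (f z)).2⁻¹ * FreeGroup.of (ev (f z)).1 * (ev (f z)).2

theorem sub_of {X Y : Type} (f : X → RackTerm Y) (z : X) : sub f (FreeGroup.of z) =
    (ev (f z)).2⁻¹ * FreeGroup.of (ev (f z)).1 * (ev (f z)).2 := by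
  simp [sub]

theorem ev_bind {X Y : Type} (f : X → RackTerm Y) (t : RackTerm X) :
    ev (t.bind f) = ((ev (f (ev t).1)).1, (ev (f (ev t).1)).2 * sub f (ev t).2) := by
  induction t with
  | gen x => simp [RackTerm.bind, ev]
  | tri a b ha hb =>
    simp only [RackTerm.bind, ev, ha, hb, map_mul, map_inv, sub_of]
    ext1; rfl; simp only; group
  | triInv a b ha hb =>
    simp only [RackTerm.bind, ev, ha, hb, map_mul, map_inv, sub_of]
    ext1; rfl; simp only; group

/-- The centralizer of a free generator consists of its powers. -/
theorem centralizer {X : Type} [DecidableEq X] (x : X) : ∀ (N : ℕ) (u : FreeGroup X),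
    u.toWord.length ≤ N → u * FreeGroup.of x = FreeGroup.of x * u →
    ∃ k : ℤ, u = FreeGroup.of x ^ k := by
  intro N
  induction N with
  | zero =>
    intro u hu _
    have : u = 1 := FreeGroup.toWord_eq_nil_iff.1 (List.length_eq_zero_iff.1 (by omega))
    exact ⟨0, by simp [this]⟩
  | succ N ih =>
    intro u hu hc
    rcases hw : u.toWord with _ | ⟨⟨z, b⟩, L⟩
    · exact ⟨0, by simp [FreeGroup.toWord_eq_nil_iff.1 hw]⟩
    have hu' : u = FreeGroup.mk [(z, b)] * FreeGroup.mk L := by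
      rw [FreeGroup.mul_mk, ← FreeGroup.mk_toWord (x := u), hw]; rfl
    by_cases hz : z = x
    · subst hz
      have hL : (FreeGroup.mk L).toWord.length ≤ N := by
        have h1 : (FreeGroup.mk L).toWord.length ≤ L.length := FreeGroup.norm_mk_le
        rw [hw] at hu
        simp at hu
        omega
      obtain ⟨j, hj⟩ : ∃ j : ℤ, FreeGroup.mk [(z, b)] = FreeGroup.of z ^ j := by
        cases b
        · exact ⟨-1, by simp [FreeGroup.of, FreeGroup.invRev]⟩
        · exact ⟨1, by simp [FreeGroup.of]⟩
      have hcom : FreeGroup.mk L * FreeGroup.of z = FreeGroup.of z * FreeGroup.mk L := by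
        have h2 : FreeGroup.mk L = FreeGroup.of z ^ (-j) * u := by rw [hu', hj]; group
        rw [h2, mul_assoc, hc]; group
      obtain ⟨k, hk⟩ := ih _ hL hcom
      exact ⟨j + k, by rw [hu', hj, hk, zpow_add]⟩
    · exfalso
      have hred : FreeGroup.IsReduced ((x, true) :: u.toWord) := by
        have := FreeGroup.isReduced_toWord (x := u)
        rw [hw] at this ⊢
        rw [FreeGroup.isReduced_cons_cons]
        exact ⟨fun h => absurd h.symm hz, this⟩
      have h1 : (FreeGroup.of x * u).toWord = (x, true) :: u.toWord := by
        rw [FreeGroup.toWord_mul, FreeGroup.toWord_of]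
        exact hred.reduce_eq
      have h2 := FreeGroup.toWord_mul_sublist u (FreeGroup.of x)
      rw [hc, h1, FreeGroup.toWord_of] at h2
      have h3 := h2.eq_of_length (by simp)
      rw [hw] at h3
      simp at h3
      exact hz h3.1.1.symm

/-- The word of a power of `x` followed by a word in the `y`s. -/
abbrev wd (n : ℕ) (ds : List Bool) (w : List (Fin n × Bool)) : List (XY n × Bool) :=
  (ds.map fun d => ((none : XY n), d)) ++ w.map fun p => ((some p.1 : XY n), p.2)

theorem mk_wd (n : ℕ) (ds : List Bool) (w : List (Fin n × Bool)) :
    ∃ k : ℤ, FreeGroup.mk (wd n ds w) =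
      FreeGroup.of none ^ k * FreeGroup.map some (FreeGroup.mk w) := by
  rw [wd, ← FreeGroup.mul_mk, FreeGroup.map.mk]
  suffices h : ∃ k : ℤ, FreeGroup.mk (ds.map fun d => ((none : XY n), d)) =
      FreeGroup.of none ^ k by
    obtain ⟨k, hk⟩ := h
    exact ⟨k, by rw [hk]⟩
  induction ds with
  | nil => exact ⟨0, rfl⟩
  | cons d ds ih =>
    obtain ⟨k, hk⟩ := ih
    have h : FreeGroup.mk ((d :: ds).map fun d => ((none : XY n), d)) =
        FreeGroup.mk [(none, d)] * FreeGroup.mk (ds.map fun d => ((none : XY n), d)) := by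
      simp [FreeGroup.mul_mk]
    rw [h, hk]
    cases d
    · refine ⟨-1 + k, ?_⟩
      rw [zpow_add]; simp [FreeGroup.of, FreeGroup.invRev]
    · refine ⟨1 + k, ?_⟩
      rw [zpow_add]; simp [FreeGroup.of]

theorem exists_wd (n : ℕ) (k : ℤ) (v : FreeGroup (Fin n)) :
    ∃ ds w, ReducedWord (wd n ds w) ∧
      FreeGroup.mk (wd n ds w) = FreeGroup.of none ^ k * FreeGroup.map some v := by
  obtain ⟨d, m, hm⟩ : ∃ (d : Bool) (m : ℕ),
      FreeGroup.mk (List.replicate m ((none : XY n), d)) = FreeGroup.of none ^ k := by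
    obtain ⟨m, rfl | rfl⟩ := k.eq_nat_or_neg
    · refine ⟨true, m, ?_⟩
      rw [zpow_natCast, ← FreeGroup.toWord_of_pow, FreeGroup.mk_toWord]
    · refine ⟨false, m, ?_⟩
      rw [zpow_neg, zpow_natCast, ← FreeGroup.mk_toWord (x := FreeGroup.of none ^ m),
        FreeGroup.toWord_of_pow, FreeGroup.inv_mk]
      simp [FreeGroup.invRev]
  refine ⟨List.replicate m d, v.toWord, ?_, ?_⟩
  · change List.IsChain _ _
    rw [List.isChain_append]
    refine ⟨?_, ?_, ?_⟩
    · rw [List.map_replicate]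
      exact List.isChain_replicate_of_rel _ (fun _ => rfl)
    · rw [List.isChain_map]
      have := FreeGroup.isReduced_toWord (x := v)
      exact List.IsChain.imp (fun a b h h' => h (Option.some.inj h')) this
    · intro a ha b hb h
      have ha' := List.mem_of_mem_getLast? ha
      have hb' := List.mem_of_mem_head? hb
      simp only [List.mem_map] at ha' hb'
      obtain ⟨_, _, rfl⟩ := ha'
      obtain ⟨_, _, rfl⟩ := hb'
      simp at h
  · rw [wd, ← FreeGroup.mul_mk, List.map_replicate, hm, ← FreeGroup.map.mk, FreeGroup.mk_toWord]

/-- Kill `x₀`, send `x₁` to `x`. -/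
def psi (n : ℕ) : FreeGroup (XXY n) →* FreeGroup (XY n) :=
  FreeGroup.lift (Sum.elim (fun b => if b then FreeGroup.of none else 1)
    (fun i => FreeGroup.of (some i)))

/-- Kill `x`. -/
def kill (n : ℕ) : FreeGroup (XY n) →* FreeGroup (Fin n) :=
  FreeGroup.lift (fun a => a.elim 1 FreeGroup.of)

theorem isotropy_imp (n : ℕ) (t : RackTerm (XY n)) (h : IsRckIsotropy n t) :
    ∃ (k : ℤ) (v : FreeGroup (Fin n)),
      ev t = (none, FreeGroup.of none ^ k * FreeGroup.map some v) := by
  obtain ⟨⟨tinv, h1, -⟩, h2⟩ := h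
  have ha : (ev t).1 = none := by
    have := congrArg Prod.fst (ev_sound h1)
    rw [RackTerm.subst, ev_bind] at this
    by_contra hne
    simp only [if_neg hne, ev] at this
    exact hne this
  have h3 := congrArg (fun p => psi n p.2) (ev_sound (h2 true))
  have e1 : (psi n).comp (sub (genMap n ((RackTerm.gen (.inl false)).triE true
      (.gen (.inl true))))) = (FreeGroup.map some).comp (kill n) := by
    ext a; cases a <;> simp [sub_of, genMap, psi, kill, ev, ev_triE, FreeGroup.invRev]
  have e2 : (psi n).comp (sub (genMap n (RackTerm.gen (.inl false)))) =
      (FreeGroup.map some).comp (kill n) := by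
    ext a; cases a <;> simp [sub_of, genMap, psi, kill, ev]
  have e3 : (psi n).comp (sub (genMap n (RackTerm.gen (.inl true)))) = MonoidHom.id _ := by
    ext a; cases a <;> simp [sub_of, genMap, psi, ev]
  have e1' := fun g => DFunLike.congr_fun e1 g
  have e2' := fun g => DFunLike.congr_fun e2 g
  have e3' := fun g => DFunLike.congr_fun e3 g
  simp only [MonoidHom.comp_apply, MonoidHom.id_apply] at e1' e2' e3'
  simp only [ev_triE, ev_bind, ha, map_mul, map_inv, e1', e2', e3'] at h3
  have p1 : psi n (FreeGroup.mk [(Sum.inl true, true)]) = FreeGroup.of none := by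
    simp [psi]
  simp only [genMap, Option.elim, ev, ev_triE, map_mul, map_one, inv_one, one_mul, mul_one, p1]
    at h3
  set g := (ev t).2 with hg
  set w := FreeGroup.map some (kill n g) with hw
  obtain ⟨k, hk⟩ := centralizer none _ (g * w⁻¹) le_rfl (by
    have : FreeGroup.of none = w * (g⁻¹ * FreeGroup.of none * g) * w⁻¹ := by
      rw [← h3]; group
    calc g * w⁻¹ * FreeGroup.of none
        = g * w⁻¹ * (w * (g⁻¹ * FreeGroup.of none * g) * w⁻¹) := by rw [← this]
      _ = _ := by group)
  refine ⟨k, kill n g, ?_⟩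
  ext1
  · exact ha
  · rw [← hk, ← hw]; simp [hg]

theorem imp_isotropy (n : ℕ) (t : RackTerm (XY n)) (k : ℤ) (v : FreeGroup (Fin n))
    (h : ev t = (none, FreeGroup.of none ^ k * FreeGroup.map some v)) : IsRckIsotropy n t := by
  have hsub : ∀ (s : RackTerm (XXY n)), sub (genMap n s) (FreeGroup.map some v) =
      FreeGroup.map Sum.inr v := by
    intro s
    have : (sub (genMap n s)).comp (FreeGroup.map some) = FreeGroup.map Sum.inr := by
      ext a; simp [sub_of, genMap, ev]
    exact DFunLike.congr_fun this v
  have hsub' : ∀ (s : RackTerm (XY n)),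
      sub (fun a => if a = none then s else gen a) (FreeGroup.map some v) =
      FreeGroup.map some v := by
    intro s
    have : (sub (fun a => if a = none then s else gen a)).comp (FreeGroup.map some) =
        FreeGroup.map (some : Fin n → XY n) := by
      ext a; simp [sub_of, ev]
    exact DFunLike.congr_fun this v
  have conjz : ∀ {G : Type} [Group G] (a b : G), (a⁻¹ * b * a) ^ k = a⁻¹ * b ^ k * a := by
    intro G _ a b
    simpa using conj_zpow (i := k) (a := a⁻¹) (b := b)
  have hsub2 : ∀ (s : RackTerm (XY n)) (v' : FreeGroup (Fin n)),
      sub (fun a => if a = none then s else gen a) (FreeGroup.map some v') =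
      FreeGroup.map some v' := by
    intro s v'
    have : (sub (fun a => if a = none then s else gen a)).comp (FreeGroup.map some) =
        FreeGroup.map (some : Fin n → XY n) := by
      ext a; simp [sub_of, ev]
    exact DFunLike.congr_fun this v'
  refine ⟨?_, ?_⟩
  · set tinv : RackTerm (XY n) := (gen none).chain
      (FreeGroup.of none ^ (-k) * FreeGroup.map some v⁻¹).toWord with ht
    have hti : ev tinv = (none, FreeGroup.of none ^ (-k) * FreeGroup.map some v⁻¹) := by
      rw [ht, ev_chain, FreeGroup.mk_toWord]; simp [ev]
    refine ⟨tinv, ?_, ?_⟩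
    · rw [rel_iff, RackTerm.subst, ev_bind, h]
      simp only [map_mul, map_zpow, sub_of, hsub2, if_true, hti, conjz, ev]
      ext1
      · rfl
      · simp only [map_inv]; group
    · rw [rel_iff, RackTerm.subst, ev_bind, hti]
      have conjz' : ∀ {G : Type} [Group G] (a b : G),
          (a⁻¹ * b * a) ^ (-k) = a⁻¹ * b ^ (-k) * a := by
        intro G _ a b
        simpa using conj_zpow (i := -k) (a := a⁻¹) (b := b)
      simp only [map_mul, map_zpow, sub_of, hsub2, if_true, h, conjz', ev]
      ext1
      · rfl
      · simp only [map_inv]; group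
  · intro e
    have hg : ∀ s, ev (genMap n s none) = ev s := fun s => rfl
    rw [rel_iff]
    simp only [ev_triE, ev_bind, h, map_mul, map_zpow, sub_of, hsub, hg, conjz, ev]
    ext1
    · rfl
    · cases e
      · have : FreeGroup.mk [((Sum.inl true : XXY n), false)] = (FreeGroup.of (Sum.inl true))⁻¹ :=
          rfl
        simp only [this]; group
      · have : FreeGroup.mk [((Sum.inl true : XXY n), true)] = FreeGroup.of (Sum.inl true) :=
          rfl
        simp only [this]; group

end RackAux

/-- **Isotropy group of a free rack** (Theorem 5 of the paper).
For any rack term `t` over `{x, y₁, …, yₙ}`, the class `[t]` belongs to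
`G_Rck(n)` iff there are `p, m ≥ 0`, signs `δ₁, …, δ_p, ε₁, …, εₘ` and indices
`i₁, …, iₘ` such that
`t ~R x ◁^{δ₁} x ◁^{δ₂} ⋯ ◁^{δ_p} x ◁^{ε₁} y_{i₁} ◁^{ε₂} ⋯ ◁^{εₘ} y_{iₘ}`
(left-associated) and the group word
`x^{δ₁} ⋯ x^{δ_p} y_{i₁}^{ε₁} ⋯ y_{iₘ}^{εₘ}` over `{x, y₁, …, yₙ}` is
reduced. -/
theorem free_rack_isotropy (n : ℕ) (t : RackTerm (XY n)) :
    IsRckIsotropy n t ↔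
      ∃ (ds : List Bool) (w : List (Fin n × Bool)),
        ReducedWord
          ((ds.map fun d => ((none : XY n), d)) ++
            w.map fun p => ((some p.1 : XY n), p.2)) ∧
        RackRel (XY n) t
          ((RackTerm.gen none).chain
            ((ds.map fun d => ((none : XY n), d)) ++
              w.map fun p => ((some p.1 : XY n), p.2))) := by
  constructor
  · intro h
    obtain ⟨k, v, hev⟩ := RackAux.isotropy_imp n t h
    obtain ⟨ds, w, hr, hw⟩ := RackAux.exists_wd n k v
    refine ⟨ds, w, hr, ?_⟩
    rw [RackAux.rel_iff, RackAux.ev_chain, hw, hev]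
    simp [RackAux.ev]
  · rintro ⟨ds, w, -, h⟩
    obtain ⟨k, hk⟩ := RackAux.mk_wd n ds w
    refine RackAux.imp_isotropy n t k (FreeGroup.mk w) ?_
    rw [RackAux.ev_sound h, RackAux.ev_chain, hk]
    simp [RackAux.ev]
end

section
/- The isotropy group of the free rack on n generators is isomorphic, as a group, to the direct product of the integers with the free group on n generators: G_Rck(n) ≅ ℤ × FreeGroup (Fin n), where G_Rck(n) carries the multiplication given by substitution into x (with unit [x]). -/
/-- The setoid of rack terms over `{x, y₁, …, yₙ}` modulo the rack congruence
`~R`. -/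
def rckSetoid (n : ℕ) : Setoid (RackTerm (XY n)) :=
  ⟨RackRel (XY n), ⟨RackRel.refl, RackRel.symm, RackRel.trans⟩⟩

/-- The carrier of the logical isotropy group `G_Rck(n)`: the set of
`~R`-classes `[t]` of terms `t` over `{x, y₁, …, yₙ}` that are invertible and
commute generically with `◁` and `◁⁻¹`. -/
def GRck (n : ℕ) : Type :=
  {a : Quotient (rckSetoid n) //
    ∃ t : RackTerm (XY n), a = Quotient.mk (rckSetoid n) t ∧ IsRckIsotropy n t}

/-- The element `[t]` of `G_Rck(n)` determined by a term `t` satisfying the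
isotropy conditions. -/
def GRck.mk (n : ℕ) (t : RackTerm (XY n)) (h : IsRckIsotropy n t) : GRck n :=
  ⟨Quotient.mk (rckSetoid n) t, t, rfl, h⟩


namespace RckIso

/-! ### Centralizer of a generator in a free group -/

theorem commute_of_eq_zpow {X : Type} [DecidableEq X] (x : X) :
    ∀ (m : ℕ) (u : FreeGroup X), u.toWord.length ≤ m → FreeGroup.of x * u = u * FreeGroup.of x →
      ∃ k : ℤ, u = FreeGroup.of x ^ k := by
  intro m
  induction m with
  | zero =>
    intro u hu _
    refine ⟨0, ?_⟩
    have : u.toWord = [] := List.length_eq_zero_iff.1 (by omega)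
    simpa using FreeGroup.toWord_eq_nil_iff.1 this
  | succ m ih =>
    intro u hu hc
    have hmk : FreeGroup.mk u.toWord = u := FreeGroup.mk_toWord
    have hone : ∀ b : Bool, ∃ e : ℤ, FreeGroup.mk [(x, b)] = FreeGroup.of x ^ e := by
      intro b
      cases b
      · exact ⟨-1, by simp [FreeGroup.of, FreeGroup.invRev]⟩
      · exact ⟨1, by simp [FreeGroup.of]⟩
    have hlen : ∀ L : List (X × Bool), L.length ≤ m → (FreeGroup.mk L).toWord.length ≤ m := by
      intro L hL
      exact le_trans FreeGroup.norm_mk_le hL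
    have hcz : ∀ e : ℤ, FreeGroup.of x ^ e * u = u * FreeGroup.of x ^ e := by
      intro e
      exact (Commute.zpow_left (show Commute (FreeGroup.of x) u from hc) e)
    by_cases hnil : u.toWord = []
    · exact ⟨0, by simpa using FreeGroup.toWord_eq_nil_iff.1 hnil⟩
    by_cases h1 : ∃ b L, u.toWord = (x, b) :: L
    · obtain ⟨b, L, hL⟩ := h1
      obtain ⟨e, he⟩ := hone b
      have hu2 : u = FreeGroup.of x ^ e * FreeGroup.mk L := by
        rw [← he, FreeGroup.mul_mk, ← hmk, hL]; rfl
      have hc2 : FreeGroup.of x * FreeGroup.mk L = FreeGroup.mk L * FreeGroup.of x := by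
        have hv : FreeGroup.mk L = (FreeGroup.of x ^ e)⁻¹ * u := by rw [hu2]; group
        rw [hv]
        have : Commute (FreeGroup.of x) ((FreeGroup.of x ^ e)⁻¹ * u) :=
          Commute.mul_right ((Commute.refl _).zpow_right e).inv_right hc
        exact this
      obtain ⟨k, hk⟩ := ih _ (hlen L (by rw [hL] at hu; simpa using hu)) hc2
      exact ⟨e + k, by rw [hu2, hk, zpow_add]⟩
    by_cases h2 : ∃ b L, u.toWord = L ++ [(x, b)]
    · obtain ⟨b, L, hL⟩ := h2
      obtain ⟨e, he⟩ := hone b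
      have hu2 : u = FreeGroup.mk L * FreeGroup.of x ^ e := by
        rw [← he, FreeGroup.mul_mk, ← hmk, hL]
      have hc2 : FreeGroup.of x * FreeGroup.mk L = FreeGroup.mk L * FreeGroup.of x := by
        have hv : FreeGroup.mk L = u * (FreeGroup.of x ^ e)⁻¹ := by rw [hu2]; group
        rw [hv]
        have : Commute (FreeGroup.of x) (u * (FreeGroup.of x ^ e)⁻¹) :=
          Commute.mul_right hc ((Commute.refl _).zpow_right e).inv_right
        exact this
      obtain ⟨k, hk⟩ := ih _ (hlen L (by rw [hL] at hu; simpa using hu)) hc2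
      exact ⟨k + e, by rw [hu2, hk, zpow_add]⟩
    · exfalso
      have hred : FreeGroup.IsReduced ((x, true) :: (u.toWord ++ [(x, false)])) := by
        have hu : FreeGroup.IsReduced u.toWord := FreeGroup.isReduced_toWord
        generalize u.toWord = W at *
        unfold FreeGroup.IsReduced at *
        rw [← List.cons_append, List.isChain_append]
        refine ⟨?_, by simp, ?_⟩
        · rw [List.isChain_cons]
          refine ⟨?_, hu⟩
          rintro ⟨y, b⟩ hy hxy
          exfalso
          cases W with
          | nil => simp at hy
          | cons a W =>
            simp at hy hxy
            exact h1 ⟨b, W, by rw [hy, hxy]⟩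
        · rintro ⟨y, b⟩ hy ⟨z, c⟩ hz hyz
          exfalso
          simp at hz hyz
          rcases List.eq_nil_or_concat W with hW | ⟨L, a, hW⟩
          · exact hnil hW
          · subst hW
            rw [List.concat_eq_append, ← List.cons_append, List.getLast?_concat] at hy
            simp at hy
            exact h2 ⟨b, L, by rw [hy, hyz, hz.1]; simp⟩
      have heq : FreeGroup.mk ((x, true) :: (u.toWord ++ [(x, false)])) = u := by
        have : FreeGroup.mk ((x, true) :: (u.toWord ++ [(x, false)]))
            = FreeGroup.of x * u * (FreeGroup.of x)⁻¹ := by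
          conv_rhs => rw [← hmk]
          simp [FreeGroup.of, FreeGroup.mul_mk, FreeGroup.invRev]
        rw [this, hc]; group
      have := congrArg FreeGroup.toWord heq
      rw [FreeGroup.toWord_mk, hred.reduce_eq] at this
      have := congrArg List.length this
      simp at this
      omega

/-! ### The free rack -/

open RackTerm

/-- The element of the free group associated with an element of the free rack. -/
def cj {X : Type} (p : X × FreeGroup X) : FreeGroup X := p.2 * FreeGroup.of p.1 * p.2⁻¹

/-- Evaluation of terms in the free rack `X × FreeGroup X`. -/
def ev {X : Type} : RackTerm X → X × FreeGroup X
  | gen x => (x, 1)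
  | tri a b => ((ev a).1, cj (ev b) * (ev a).2)
  | triInv a b => ((ev a).1, (cj (ev b))⁻¹ * (ev a).2)

theorem ev_of_rel {X : Type} {a b : RackTerm X} (h : RackRel X a b) : ev a = ev b := by
  induction h with
  | refl => rfl
  | symm _ ih => exact ih.symm
  | trans _ _ ih1 ih2 => exact ih1.trans ih2
  | congr_tri _ _ ih1 ih2 => simp [ev, ih1, ih2]
  | congr_triInv _ _ ih1 ih2 => simp [ev, ih1, ih2]
  | self_distrib a b c => simp [ev, cj]; group
  | self_distrib_inv a b c => simp [ev, cj]; group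
  | cancel a b => simp [ev]
  | cancel_inv a b => simp [ev]

theorem ev_bind {X Y : Type} (t : RackTerm X) (f : X → RackTerm Y) :
    ev (t.bind f) = ((ev (f (ev t).1)).1,
      FreeGroup.lift (fun a => cj (ev (f a))) (ev t).2 * (ev (f (ev t).1)).2) := by
  induction t with
  | gen x => simp [RackTerm.bind, ev]
  | tri a b iha ihb => simp [RackTerm.bind, ev, iha, ihb, cj, mul_assoc]
  | triInv a b iha ihb => simp [RackTerm.bind, ev, iha, ihb, cj, mul_assoc]

/-- The rack congruence as a setoid. -/
def st (X : Type) : Setoid (RackTerm X) :=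
  ⟨RackRel X, ⟨RackRel.refl, RackRel.symm, RackRel.trans⟩⟩

/-- The quotient of terms by the rack congruence. -/
abbrev Q (X : Type) : Type := Quotient (st X)

/-- The operation on the quotient. -/
def qt {X : Type} : Q X → Q X → Q X :=
  Quotient.map₂ RackTerm.tri (fun _ _ h _ _ h' => RackRel.congr_tri h h')

/-- The inverse operation on the quotient. -/
def qi {X : Type} : Q X → Q X → Q X :=
  Quotient.map₂ RackTerm.triInv (fun _ _ h _ _ h' => RackRel.congr_triInv h h')

theorem qt_qi {X : Type} (a b : Q X) : qt (qi a b) b = a := by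
  induction a, b using Quotient.inductionOn₂ with
  | _ a b => exact Quotient.sound (RackRel.cancel_inv a b)

theorem qi_qt {X : Type} (a b : Q X) : qi (qt a b) b = a := by
  induction a, b using Quotient.inductionOn₂ with
  | _ a b => exact Quotient.sound (RackRel.cancel a b)

theorem qt_dist {X : Type} (a b c : Q X) : qt (qt a b) c = qt (qt a c) (qt b c) := by
  induction a, b, c using Quotient.inductionOn₃ with
  | _ a b c => exact Quotient.sound (RackRel.self_distrib a b c)

/-- Right translation as a permutation. -/
def rt {X : Type} (b : Q X) : Equiv.Perm (Q X) :=
  ⟨fun a => qt a b, fun a => qi a b, fun a => qi_qt a b, fun a => qt_qi a b⟩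

/-- The free group acts on the quotient. -/
def act {X : Type} : FreeGroup X →* Equiv.Perm (Q X) :=
  FreeGroup.lift fun x => rt (Quotient.mk (st X) (gen x))

/-- Automorphisms of the quotient rack. -/
def autS (X : Type) : Subgroup (Equiv.Perm (Q X)) where
  carrier := {p | ∀ a b, p (qt a b) = qt (p a) (p b)}
  mul_mem' := by
    intro p q hp hq a b
    simp [hq a b, hp (q a) (q b)]
  one_mem' := by intro a b; rfl
  inv_mem' := by
    intro p hp a b
    rw [Equiv.Perm.inv_eq_iff_eq, hp]
    simp

theorem act_mem {X : Type} (g : FreeGroup X) : act g ∈ autS X := by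
  induction g using FreeGroup.induction_on with
  | C1 => simpa using (autS X).one_mem
  | of x => 
    intro a b
    simp only [act, FreeGroup.lift_apply_of]
    exact qt_dist _ _ _
  | inv_of x h => rw [map_inv]; exact (autS X).inv_mem h
  | mul x y hx hy => rw [map_mul]; exact (autS X).mul_mem hx hy

/-- Reading back a term class. -/
def rd {X : Type} (p : X × FreeGroup X) : Q X := act p.2 (Quotient.mk (st X) (gen p.1))

theorem act_cj {X : Type} (p : X × FreeGroup X) : act (cj p) = rt (rd p) := by
  ext1 a
  have h := act_mem p.2 ((act p.2)⁻¹ a) (Quotient.mk (st X) (gen p.1))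
  simp only [cj, map_mul, map_inv, Equiv.Perm.mul_apply]
  rw [show act p.2 ((act p.2)⁻¹ a) = a from (act p.2).apply_symm_apply a] at h
  rw [show (rt (rd p)) a = qt a (rd p) from rfl]
  unfold rd
  rw [← h]
  simp [act]
  rfl

theorem rd_ev {X : Type} (t : RackTerm X) : rd (ev t) = Quotient.mk (st X) t := by
  induction t with
  | gen x => simp [rd, ev]
  | tri a b iha ihb =>
    have : rd (ev (tri a b)) = act (cj (ev b)) (rd (ev a)) := by simp [rd, ev]
    rw [this, act_cj, iha, ihb]; rfl
  | triInv a b iha ihb =>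
    have : rd (ev (triInv a b)) = (act (cj (ev b)))⁻¹ (rd (ev a)) := by simp [rd, ev]
    rw [this, act_cj, iha, ihb]; rfl

theorem rel_iff {X : Type} {a b : RackTerm X} : RackRel X a b ↔ ev a = ev b := by
  refine ⟨ev_of_rel, fun h => ?_⟩
  have : Quotient.mk (st X) a = Quotient.mk (st X) b := by rw [← rd_ev, ← rd_ev, h]
  exact Quotient.exact this

theorem ev_surj {X : Type} (x : X) (g : FreeGroup X) : ∃ t, ev t = (x, g) := by
  have : ∀ h : FreeGroup X, ∀ s : RackTerm X, ∃ t, ev t = ((ev s).1, h * (ev s).2) := by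
    intro h
    induction h using FreeGroup.induction_on with
    | C1 => intro s; exact ⟨s, by simp⟩
    | of y => intro s; exact ⟨s.tri (gen y), by simp [ev, cj]⟩
    | inv_of y _ => intro s; exact ⟨s.triInv (gen y), by simp [ev, cj]⟩
    | mul a b iha ihb =>
      intro s
      obtain ⟨t, ht⟩ := ihb s
      obtain ⟨t', ht'⟩ := iha t
      exact ⟨t', by rw [ht', ht]; simp [mul_assoc]⟩
  obtain ⟨t, ht⟩ := this g (gen x)
  exact ⟨t, by rw [ht]; simp [ev]⟩

/-! ### The isotropy group -/

/-- The comparison homomorphism. -/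
def pr (n : ℕ) : FreeGroup (XY n) →* Multiplicative ℤ × FreeGroup (Fin n) :=
  FreeGroup.lift fun a => a.elim (Multiplicative.ofAdd 1, 1) fun i => (1, FreeGroup.of i)

/-- The inclusion of the free group on the `yᵢ`. -/
def inc (n : ℕ) : FreeGroup (Fin n) →* FreeGroup (XY n) := FreeGroup.map some

theorem pr_nf (n : ℕ) (h : FreeGroup (Fin n)) (k : ℤ) :
    pr n (inc n h * FreeGroup.of none ^ k) = (Multiplicative.ofAdd k, h) := by
  have h1 : (pr n).comp (inc n) = MonoidHom.inr _ _ := by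
    ext i <;> simp [pr, inc]
  have h2 : pr n (inc n h) = (1, h) := by
    simpa using DFunLike.congr_fun h1 h
  rw [map_mul, map_zpow, h2]
  simp only [pr, FreeGroup.lift_apply_of, Option.elim]
  ext
  · simp [← ofAdd_zsmul]
  · simp

theorem left_of_iso {n : ℕ} {t : RackTerm (XY n)} (h : IsRckIsotropy n t) : (ev t).1 = none := by
  obtain ⟨⟨s, h1, -⟩, -⟩ := h
  have h2 := congrArg Prod.fst (ev_of_rel h1)
  unfold subst at h2
  rw [ev_bind] at h2
  by_contra hne
  simp [hne, ev] at h2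

/-- The action of a substitution `x ↦ s` on free group elements. -/
def sb (n : ℕ) (s : RackTerm (XXY n)) : FreeGroup (XY n) →* FreeGroup (XXY n) :=
  FreeGroup.lift fun a => cj (ev (genMap n s a))

theorem sb_none (n : ℕ) (s : RackTerm (XXY n)) : sb n s (FreeGroup.of none) = cj (ev s) := by
  simp [sb, genMap]

theorem sb_some (n : ℕ) (s : RackTerm (XXY n)) (i : Fin n) :
    sb n s (FreeGroup.of (some i)) = FreeGroup.of (.inr i) := by
  simp [sb, genMap, ev, cj]

theorem sb_inc (n : ℕ) (s : RackTerm (XXY n)) (u : FreeGroup (Fin n)) :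
    sb n s (inc n u) = FreeGroup.map Sum.inr u := by
  have : (sb n s).comp (inc n) = FreeGroup.map Sum.inr := by
    ext1 i
    simp [inc, sb_some]
  exact DFunLike.congr_fun this u

theorem ev_genMap {n : ℕ} {t : RackTerm (XY n)} {g : FreeGroup (XY n)} (h : ev t = (none, g))
    (s : RackTerm (XXY n)) : ev (t.bind (genMap n s)) = ((ev s).1, sb n s g * (ev s).2) := by
  rw [ev_bind, h]
  simp [genMap, sb]

theorem nf_of_iso {n : ℕ} {t : RackTerm (XY n)} (h : IsRckIsotropy n t) :
    ∃ (u : FreeGroup (Fin n)) (k : ℤ), ev t = (none, inc n u * FreeGroup.of none ^ k) := by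
  have hl := left_of_iso h
  have h2 := congrArg Prod.snd (ev_of_rel (h.2 true))
  obtain ⟨g, hg⟩ : ∃ g, ev t = (none, g) := ⟨(ev t).2, by rw [← hl]⟩
  simp only [triE, if_true, ev, ev_genMap hg] at h2
  -- the homomorphism killing the first copy of the generator
  let K : FreeGroup (XXY n) →* FreeGroup (XY n) :=
    FreeGroup.lift (Sum.elim (fun b => if b then FreeGroup.of none else 1)
      (fun i => FreeGroup.of (some i)))
  let v : FreeGroup (XY n) →* FreeGroup (Fin n) :=
    FreeGroup.lift fun a => a.elim 1 FreeGroup.of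
  have k1 : ∀ s, K (cj (ev s)) = 1 → ∀ g, K (sb n s g) = inc n (v g) := by
    intro s hs g
    have : K.comp (sb n s) = (inc n).comp v := by
      ext1 a
      cases a with
      | none => simp [sb_none, hs, v]
      | some i => simp [sb_some, K, v, inc]
    exact DFunLike.congr_fun this g
  have k2 : ∀ g, K (sb n (gen (.inl true)) g) = g := by
    intro g
    have : K.comp (sb n (gen (.inl true))) = MonoidHom.id _ := by
      ext1 a
      cases a with
      | none => simp [sb_none, K, ev, cj]
      | some i => simp [sb_some, K]
    exact DFunLike.congr_fun this g
  have h3 := congrArg K h2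
  simp only [map_mul, map_inv, map_one, cj, k2] at h3
  rw [k1 _ (by simp [ev, cj, K]), k1 _ (by simp [ev, cj, K])] at h3
  have kx : K (FreeGroup.of (.inl true)) = FreeGroup.of none := by simp [K]
  simp only [kx, mul_one, one_mul, inv_one] at h3
  have hc : FreeGroup.of none * ((inc n (v g))⁻¹ * g) = ((inc n (v g))⁻¹ * g) * FreeGroup.of none := by
    rw [mul_assoc, eq_inv_mul_iff_mul_eq]
    have h4 := congrArg (fun z => z * (inc n (v g))⁻¹ * g) h3
    simp only [mul_assoc] at h4
    simpa [mul_assoc] using h4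
  obtain ⟨k, hk⟩ := commute_of_eq_zpow none _ _ le_rfl hc
  exact ⟨v g, k, by rw [hg, ← hk]; simp⟩

theorem subst_nf {n : ℕ} {s t : RackTerm (XY n)} {u u' : FreeGroup (Fin n)} {k k' : ℤ}
    (hs : ev s = (none, inc n u * FreeGroup.of none ^ k))
    (ht : ev t = (none, inc n u' * FreeGroup.of none ^ k')) :
    ev (s.subst none t) = (none, inc n (u * u') * FreeGroup.of none ^ (k + k')) := by
  unfold subst
  rw [ev_bind, hs]
  simp only [if_true, ht, map_mul, map_zpow, FreeGroup.lift_apply_of]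
  have hi : FreeGroup.lift (fun a => cj (ev (if a = none then t else gen a))) (inc n u)
      = inc n u := by
    have : (FreeGroup.lift (fun a => cj (ev (if a = none then t else gen a)))).comp (inc n)
        = inc n := by
      ext1 i
      simp [inc, ev, cj]
    exact DFunLike.congr_fun this u
  rw [hi, cj, conj_zpow]
  simp only [zpow_add, Prod.mk.injEq, true_and]
  have : Commute (FreeGroup.of (none : XY n) ^ k') (FreeGroup.of none ^ k) :=
    ((Commute.refl _).zpow_left _).zpow_right _
  simp only [mul_assoc, inv_mul_cancel_left, mul_inv_rev, inv_mul_cancel, mul_one]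
  rw [this.eq]

theorem iso_of_nf {n : ℕ} {t : RackTerm (XY n)} (u : FreeGroup (Fin n)) (k : ℤ)
    (h : ev t = (none, inc n u * FreeGroup.of none ^ k)) : IsRckIsotropy n t := by
  refine ⟨?_, ?_⟩
  · obtain ⟨s, hs⟩ := ev_surj none (inc n u⁻¹ * FreeGroup.of none ^ (-k))
    refine ⟨s, rel_iff.2 ?_, rel_iff.2 ?_⟩
    · rw [subst_nf h hs]; simp [ev]
    · rw [subst_nf hs h]; simp [ev]
  · intro ε
    rw [rel_iff]
    have hz : ∀ (m : ℤ) (a : FreeGroup (XXY n)), a ^ m * a = a * a ^ m := fun m a =>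
      ((Commute.refl a).zpow_left m).eq
    have hz' : ∀ (m : ℤ) (a : FreeGroup (XXY n)), a ^ m * a⁻¹ = a⁻¹ * a ^ m := fun m a =>
      ((Commute.refl a).zpow_left m).inv_right.eq
    cases ε
    · simp only [triE, ev, ev_genMap h, Bool.false_eq_true, if_false, map_mul, map_zpow, sb_inc,
        sb_none, cj, one_mul, inv_one, mul_one, Prod.mk.injEq, true_and, mul_inv_rev]
      rw [conj_zpow]
      simp only [mul_assoc, inv_mul_cancel_left, inv_mul_cancel, mul_one, inv_inv, mul_inv_cancel]
      rw [← mul_assoc (_ ^ k) (FreeGroup.of (Sum.inl true))⁻¹, hz']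
      simp only [mul_assoc, mul_inv_cancel_left]
    · simp only [triE, ev, ev_genMap h, if_true, map_mul, map_zpow, sb_inc,
        sb_none, cj, one_mul, inv_one, mul_one, Prod.mk.injEq, true_and, mul_inv_rev, conj_zpow]
      simp only [mul_assoc, inv_mul_cancel_left, inv_mul_cancel, mul_one]
      rw [← mul_assoc (_ ^ k) (FreeGroup.of (Sum.inl true)), hz]
      simp only [mul_assoc, mul_inv_cancel_left]

/-- The comparison map. -/
def toFun (n : ℕ) (a : GRck n) : Multiplicative ℤ × FreeGroup (Fin n) :=
  pr n (Quotient.lift (s := rckSetoid n) ev (fun _ _ h => ev_of_rel h) a.1).2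

theorem toFun_mk (n : ℕ) (t : RackTerm (XY n)) (h : IsRckIsotropy n t) :
    toFun n (GRck.mk n t h) = pr n (ev t).2 := rfl

theorem toFun_bij (n : ℕ) : Function.Bijective (toFun n) := by
  constructor
  · rintro ⟨_, s, rfl, hs⟩ ⟨_, t, rfl, ht⟩ h
    change pr n (ev s).2 = pr n (ev t).2 at h
    obtain ⟨u, k, hu⟩ := nf_of_iso hs
    obtain ⟨u', k', hu'⟩ := nf_of_iso ht
    rw [hu, hu', pr_nf, pr_nf] at h
    simp at h
    apply Subtype.ext
    refine Quotient.sound (rel_iff.2 ?_)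
    rw [hu, hu', h.1, h.2]
  · rintro ⟨k, u⟩
    obtain ⟨t, ht⟩ := ev_surj none (inc n u * FreeGroup.of none ^ (k.toAdd))
    refine ⟨GRck.mk n t (iso_of_nf u _ ht), ?_⟩
    rw [toFun_mk, ht, pr_nf]; rfl

theorem toFun_mul (n : ℕ) (s t : RackTerm (XY n)) (hs : IsRckIsotropy n s)
    (ht : IsRckIsotropy n t) :
    pr n (ev (s.subst none t)).2 = pr n (ev s).2 * pr n (ev t).2 := by
  have hl := left_of_iso hs
  have hl' := left_of_iso ht
  unfold subst
  rw [ev_bind, hl]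
  simp only [if_true, map_mul]
  congr 1
  have : (pr n).comp (FreeGroup.lift fun a => cj (ev (if a = none then t else gen a))) = pr n := by
    ext1 a
    cases a with
    | none =>
      simp [cj, hl']
      rw [mul_inv_eq_iff_eq_mul]
      ext <;> simp [pr, mul_comm]
    | some i => simp [cj, ev]
  exact DFunLike.congr_fun this _

end RckIso

theorem free_rack_isotropy_iso_int_prod_freeGroup (n : ℕ) :
    ∃ e : GRck n ≃ Multiplicative ℤ × FreeGroup (Fin n),
      (∀ hu : IsRckIsotropy n (.gen none), e (GRck.mk n (.gen none) hu) = 1) ∧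
      (∀ (s t : RackTerm (XY n)) (hs : IsRckIsotropy n s) (ht : IsRckIsotropy n t)
        (hst : IsRckIsotropy n (s.subst none t)),
        e (GRck.mk n (s.subst none t) hst) = e (GRck.mk n s hs) * e (GRck.mk n t ht)) := by
  refine ⟨Equiv.ofBijective _ (RckIso.toFun_bij n), ?_, ?_⟩
  · intro hu
    simp [RckIso.toFun_mk, RckIso.ev]
  · intro s t hs ht _
    simp only [Equiv.ofBijective_apply, RckIso.toFun_mk]
    exact RckIso.toFun_mul n s t hs ht
end

section
/- Let n ≥ 0 and let π be an assignment, to each quandle Q and each quandle homomorphism h : Q_n → Q, of a quandle endomorphism π_h : Q → Q. Then π is a natural family of automorphisms over Q_n (each π_h is bijective and f ∘ π_h = π_{f∘h} ∘ f for all quandle homomorphisms h : Q_n → Q and f : Q → Q') if and only if there exists a unique reduced word y_{i_1}^{ε_1} ⋯ y_{i_m}^{ε_m} over the generators y_1, …, y_n such that for every quandle homomorphism h : Q_n → Q and every q ∈ Q, π_h(q) = q ◁^{ε_1} h(y_{i_1}) ◁^{ε_2} … ◁^{ε_m} h(y_{i_m}) (left-associated). -/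
/-- A rack: a set with binary operations `act` (`◁`) and `invAct` (`◁⁻¹`)
satisfying self-distributivity of `◁` and of `◁⁻¹` and the two cancellation
laws `(a ◁ b) ◁⁻¹ b = a` and `(a ◁⁻¹ b) ◁ b = a`.  (The operations act on the
right, matching the conventions `g ◁ h = h⁻¹·g·h` of the free models; with
this convention, self-distributivity reads `(a ◁ b) ◁ c = (a ◁ c) ◁ (b ◁ c)`.) -/
structure RackS (α : Type) where
  act : α → α → α
  invAct : α → α → α
  self_distrib : ∀ a b c, act (act a b) c = act (act a c) (act b c)
  self_distrib_inv : ∀ a b c, invAct (invAct a b) c = invAct (invAct a c) (invAct b c)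
  act_invAct : ∀ a b, invAct (act a b) b = a
  invAct_act : ∀ a b, act (invAct a b) b = a

/-- A quandle: a rack which moreover satisfies `a ◁ a = a` and `a ◁⁻¹ a = a`. -/
structure QuandleS (α : Type) extends RackS α where
  act_self : ∀ a, act a a = a
  invAct_self : ∀ a, invAct a a = a

/-- The left-associated chain `a ◁^{ε₁} b₁ ◁^{ε₂} ⋯ ◁^{εₘ} bₘ` in a rack,
where the list consists of the pairs `(bⱼ, εⱼ)` (`true` codes the exponent
`+1`, i.e. `◁`, and `false` codes `-1`, i.e. `◁⁻¹`). -/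
def RackS.chainAct {α : Type} (q : RackS α) (a : α) : List (α × Bool) → α
  | [] => a
  | p :: l => q.chainAct (if p.2 then q.act a p.1 else q.invAct a p.1) l

/-- A rack homomorphism: a map preserving `◁` and `◁⁻¹`. -/
def IsRackHom {α β : Type} (qa : RackS α) (qb : RackS β) (f : α → β) : Prop :=
  (∀ a b, f (qa.act a b) = qb.act (f a) (f b)) ∧
  (∀ a b, f (qa.invAct a b) = qb.invAct (f a) (f b))

/-- A quandle homomorphism: a map preserving `◁` and `◁⁻¹`. -/
def IsQuandleHom {α β : Type} (qa : QuandleS α) (qb : QuandleS β) (f : α → β) : Prop :=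
  IsRackHom qa.toRackS qb.toRackS f

/-- The carrier of the free quandle `Qₙ` on `n` generators: the set of elements
of `FreeGroup (Fin n)` that are conjugate to some generator. -/
def FreeQndC (n : ℕ) : Type :=
  {g : FreeGroup (Fin n) // ∃ i : Fin n, IsConj (FreeGroup.of i) g}

/-- The free quandle `Qₙ` on `n` generators, with operations
`g ◁ h = h⁻¹·g·h` and `g ◁⁻¹ h = h·g·h⁻¹`. -/
def freeQnd (n : ℕ) : QuandleS (FreeQndC n) where
  act a b := ⟨b.1⁻¹ * a.1 * b.1, by
    obtain ⟨i, hi⟩ := a.2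
    exact ⟨i, hi.trans (isConj_iff.2 ⟨b.1⁻¹, by group⟩)⟩⟩
  invAct a b := ⟨b.1 * a.1 * b.1⁻¹, by
    obtain ⟨i, hi⟩ := a.2
    exact ⟨i, hi.trans (isConj_iff.2 ⟨b.1, by group⟩)⟩⟩
  self_distrib a b c := Subtype.ext (by show _ * _ * _ = _ * _ * _; group)
  self_distrib_inv a b c := Subtype.ext (by show _ * _ * _ = _ * _ * _; group)
  act_invAct a b := Subtype.ext (by show _ * _ * _ = _; group)
  invAct_act a b := Subtype.ext (by show _ * _ * _ = _; group)
  act_self a := Subtype.ext (by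
    obtain ⟨i, hi⟩ := a.2
    show a.1⁻¹ * a.1 * a.1 = a.1
    group)
  invAct_self a := Subtype.ext (by show _ * _ * _ = _; group)

/-- The generator `yᵢ` of the free quandle `Qₙ`: the image of the `i`-th
free-group generator. -/
def yQ (n : ℕ) (i : Fin n) : FreeQndC n := ⟨FreeGroup.of i, i, IsConj.refl _⟩

/-- A natural family of automorphisms over the free quandle `Qₙ`: an
assignment, to each quandle `Q` and each quandle homomorphism `h : Qₙ → Q`, of
a bijective quandle endomorphism `π_h : Q → Q`, natural in the sense that
`f ∘ π_h = π_{f ∘ h} ∘ f` for all quandle homomorphisms `h : Qₙ → Q` and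
`f : Q → Q'`. -/
def IsNaturalFamilyQ (n : ℕ)
    (π : ∀ (Q : Type) (q : QuandleS Q), (FreeQndC n → Q) → Q → Q) : Prop :=
  (∀ (Q : Type) (q : QuandleS Q) (h : FreeQndC n → Q), IsQuandleHom (freeQnd n) q h →
      IsQuandleHom q q (π Q q h) ∧ Function.Bijective (π Q q h)) ∧
  (∀ (Q : Type) (q : QuandleS Q) (Q' : Type) (q' : QuandleS Q')
      (h : FreeQndC n → Q) (f : Q → Q'),
      IsQuandleHom (freeQnd n) q h → IsQuandleHom q q' f →
      f ∘ π Q q h = π Q' q' (f ∘ h) ∘ f)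

/-- An endomorphism `h₀ : Qₙ → Qₙ` is a categorical inner automorphism iff some
natural family of automorphisms `π` over `Qₙ` satisfies `π_{id} = h₀`. -/
def IsCatInnerQ (n : ℕ) (h0 : FreeQndC n → FreeQndC n) : Prop :=
  ∃ π, IsNaturalFamilyQ n π ∧ π (FreeQndC n) (freeQnd n) id = h0

namespace NatFam

/-- Centralizer of a generator in a free group. -/
theorem centralizer_of {α : Type} [DecidableEq α] (i : α) :
    ∀ L : List (α × Bool), FreeGroup.IsReduced L →
      FreeGroup.mk L * FreeGroup.of i = FreeGroup.of i * FreeGroup.mk L →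
      FreeGroup.mk L ∈ Subgroup.zpowers (FreeGroup.of i)
  | [], _, _ => by
    rw [← FreeGroup.one_eq_mk]; exact one_mem _
  | (a, b) :: T, hL, hc => by
    have hT : FreeGroup.IsReduced T := List.IsChain.tail hL
    have hsplit : FreeGroup.mk ((a, b) :: T) = FreeGroup.mk [(a, b)] * FreeGroup.mk T := by
      rw [FreeGroup.mul_mk]; rfl
    by_cases hai : a = i
    · subst hai
      have hmem : FreeGroup.mk [(a, b)] ∈ Subgroup.zpowers (FreeGroup.of a) := by
        cases b
        · have : FreeGroup.mk [(a, false)] = (FreeGroup.of a)⁻¹ := rfl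
          rw [this]; exact inv_mem (Subgroup.mem_zpowers _)
        · exact Subgroup.mem_zpowers _
      have hcomm : FreeGroup.mk [(a, b)] * FreeGroup.of a
          = FreeGroup.of a * FreeGroup.mk [(a, b)] := by
        obtain ⟨k, hk⟩ := hmem
        simp only at hk
        rw [← hk]
        exact ((Commute.refl (FreeGroup.of a)).zpow_left k)
      rw [hsplit]
      refine mul_mem hmem (centralizer_of a T hT ?_)
      rw [hsplit, mul_assoc, ← mul_assoc (FreeGroup.of a), ← hcomm, mul_assoc] at hc
      exact mul_left_cancel hc
    · exfalso
      have hred : FreeGroup.IsReduced ((i, true) :: (a, b) :: T) :=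
        FreeGroup.isReduced_cons_cons.2 ⟨fun h => absurd h.symm hai, hL⟩
      have h1 : (FreeGroup.of i * FreeGroup.mk ((a, b) :: T)).toWord
          = (i, true) :: (a, b) :: T := by
        have : FreeGroup.of i * FreeGroup.mk ((a, b) :: T)
            = FreeGroup.mk ((i, true) :: (a, b) :: T) := by
          rw [FreeGroup.of, FreeGroup.mul_mk]; rfl
        rw [this, FreeGroup.toWord_mk, hred.reduce_eq]
      have h2 := FreeGroup.toWord_mul_sublist (FreeGroup.mk ((a, b) :: T)) (FreeGroup.of i)
      rw [hc, h1, FreeGroup.toWord_mk, hL.reduce_eq, FreeGroup.toWord_of] at h2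
      have h3 := h2.eq_of_length (by simp)
      simp only [List.cons_append, List.cons.injEq, Prod.mk.injEq] at h3
      exact hai h3.1.1.symm

/-- The translation `a ↦ a ◁ b` as a permutation. -/
def sig {Q : Type} (q : QuandleS Q) (b : Q) : Equiv.Perm Q where
  toFun a := q.act a b
  invFun a := q.invAct a b
  left_inv a := q.act_invAct a b
  right_inv a := q.invAct_act a b

/-- The right action of the free group on `Q` through elements `c i`. -/
def ract {Q : Type} (q : QuandleS Q) {X : Type} (c : X → Q) (x : Q) (g : FreeGroup X) : Q :=
  FreeGroup.lift (fun i => (sig q (c i))⁻¹) g⁻¹ x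

section
variable {Q : Type} (q : QuandleS Q) {X : Type} (c : X → Q)

theorem ract_one (x : Q) : ract q c x 1 = x := by simp [ract]

theorem ract_mul (x : Q) (g h : FreeGroup X) :
    ract q c x (g * h) = ract q c (ract q c x g) h := by
  simp only [ract, mul_inv_rev, map_mul, Equiv.Perm.mul_apply]

theorem ract_of (x : Q) (i : X) : ract q c x (FreeGroup.of i) = q.act x (c i) := by
  simp only [ract, map_inv, FreeGroup.lift_apply_of, inv_inv]; rfl

theorem ract_of_inv (x : Q) (i : X) : ract q c x (FreeGroup.of i)⁻¹ = q.invAct x (c i) := by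
  simp only [ract, inv_inv, FreeGroup.lift_apply_of]; rfl

theorem ract_bij (g : FreeGroup X) : Function.Bijective (fun x => ract q c x g) :=
  (FreeGroup.lift (fun i => (sig q (c i))⁻¹) g⁻¹).bijective

theorem chain_eq (w : List (X × Bool)) (x : Q) :
    q.chainAct x (w.map fun p => (c p.1, p.2)) = ract q c x (FreeGroup.mk w) := by
  induction w generalizing x with
  | nil => rw [← FreeGroup.one_eq_mk, ract_one]; rfl
  | cons p T ih =>
    obtain ⟨a, b⟩ := p
    have hsplit : FreeGroup.mk ((a, b) :: T) = FreeGroup.mk [(a, b)] * FreeGroup.mk T := by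
      rw [FreeGroup.mul_mk]; rfl
    rw [hsplit, ract_mul, ← ih, List.map_cons, RackS.chainAct]
    congr 1
    cases b
    · exact (ract_of_inv q c x a).symm
    · exact (ract_of q c x a).symm

/-- Homomorphisms commute with the right action. -/
theorem ract_natural {Q' : Type} (q' : QuandleS Q') {f : Q → Q'} (hf : IsQuandleHom q q' f)
    (g : FreeGroup X) (x : Q) : f (ract q c x g) = ract q' (f ∘ c) (f x) g := by
  induction g using FreeGroup.induction_on generalizing x with
  | C1 => rw [ract_one, ract_one]
  | of i => rw [ract_of, ract_of, hf.1]; rfl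
  | inv_of i _ => rw [ract_of_inv, ract_of_inv, hf.2]; rfl
  | mul g h ihg ihh => rw [ract_mul, ract_mul, ihh, ihg]

theorem act_inv_distrib (a b d : Q) :
    q.invAct (q.act a b) d = q.act (q.invAct a d) (q.invAct b d) := by
  have := q.self_distrib (q.invAct a d) (q.invAct b d) d
  rw [q.invAct_act, q.invAct_act] at this
  rw [← this, q.act_invAct]

theorem ract_act (g : FreeGroup X) (a b : Q) :
    ract q c (q.act a b) g = q.act (ract q c a g) (ract q c b g) := by
  induction g using FreeGroup.induction_on generalizing a b with
  | C1 => simp only [ract_one]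
  | of i => simp only [ract_of]; exact q.self_distrib _ _ _
  | inv_of i _ => simp only [ract_of_inv]; exact act_inv_distrib q _ _ _
  | mul g h ihg ihh => simp only [ract_mul, ihg, ihh]

theorem ract_inv_cancel (x : Q) (g : FreeGroup X) : ract q c (ract q c x g⁻¹) g = x := by
  rw [← ract_mul, inv_mul_cancel, ract_one]

theorem ract_conj (a : Q) (i : X) (u : FreeGroup X) :
    ract q c a (u⁻¹ * FreeGroup.of i * u) = q.act a (ract q c (c i) u) := by
  rw [ract_mul, ract_mul, ract_of, ract_act, ract_inv_cancel]

theorem ract_conj_inv (a : Q) (i : X) (u : FreeGroup X) :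
    ract q c a (u⁻¹ * FreeGroup.of i * u)⁻¹ = q.invAct a (ract q c (c i) u) := by
  have h := ract_inv_cancel q c a (u⁻¹ * FreeGroup.of i * u)
  rw [ract_conj] at h
  rw [← q.act_invAct (ract q c a _) (ract q c (c i) u), h]

theorem ract_stab (i : X) (g : FreeGroup X) (hg : g ∈ Subgroup.zpowers (FreeGroup.of i)) :
    ract q c (c i) g = c i := by
  obtain ⟨k, rfl⟩ := hg
  simp only
  induction k using Int.induction_on with
  | zero => rw [zpow_zero, ract_one]
  | succ k ih => rw [zpow_add_one, ract_mul, ih, ract_of, q.act_self]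
  | pred k ih => rw [zpow_sub_one, ract_mul, ih, ract_of_inv, q.invAct_self]
end

theorem exists_conj {n : ℕ} (g : FreeQndC n) :
    ∃ (i : Fin n) (u : FreeGroup (Fin n)), g.1 = u⁻¹ * FreeGroup.of i * u := by
  obtain ⟨i, hi⟩ := g.2
  obtain ⟨c, hc⟩ := isConj_iff.1 hi
  exact ⟨i, c⁻¹, by rw [inv_inv, hc]⟩

theorem conj_unique {n : ℕ} {i j : Fin n} {u v : FreeGroup (Fin n)}
    (h : u⁻¹ * FreeGroup.of i * u = v⁻¹ * FreeGroup.of j * v) :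
    i = j ∧ u * v⁻¹ ∈ Subgroup.zpowers (FreeGroup.of i) := by
  have hij : i = j := by
    by_contra hne
    have := congrArg (FreeGroup.lift
      (fun k : Fin n => Multiplicative.ofAdd (if k = i then (1 : ℤ) else 0))) h
    simp only [map_mul, map_inv, FreeGroup.lift_apply_of, inv_mul_cancel_comm, if_true] at this
    rw [if_neg (Ne.symm hne)] at this
    exact absurd (Multiplicative.ofAdd.injective this) one_ne_zero
  subst hij
  refine ⟨rfl, ?_⟩
  have := centralizer_of i (u * v⁻¹).toWord FreeGroup.isReduced_toWord
  rw [FreeGroup.mk_toWord] at this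
  apply this
  have h2 : FreeGroup.of i = u * (v⁻¹ * FreeGroup.of i * v) * u⁻¹ := by rw [← h]; group
  calc u * v⁻¹ * FreeGroup.of i = u * (v⁻¹ * FreeGroup.of i * v) * u⁻¹ * (u * v⁻¹) := by group
    _ = _ := by rw [← h2]

/-- The homomorphism out of the free quandle with prescribed values on the generators. -/
noncomputable def liftQ {Q : Type} (q : QuandleS Q) {n : ℕ} (c : Fin n → Q) (g : FreeQndC n) : Q :=
  ract q c (c (exists_conj g).choose) (exists_conj g).choose_spec.choose

theorem liftQ_eq {Q : Type} (q : QuandleS Q) {n : ℕ} (c : Fin n → Q) (g : FreeQndC n)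
    (i : Fin n) (u : FreeGroup (Fin n)) (h : g.1 = u⁻¹ * FreeGroup.of i * u) :
    liftQ q c g = ract q c (c i) u := by
  have hs := (exists_conj g).choose_spec.choose_spec
  unfold liftQ
  generalize (exists_conj g).choose_spec.choose = v at *
  generalize (exists_conj g).choose = j at *
  obtain ⟨rfl, hm⟩ := conj_unique (hs.symm.trans h)
  have h1 := ract_stab q c j _ hm
  rw [show v = (v * u⁻¹) * u by group, ract_mul, h1]

theorem liftQ_hom {Q : Type} (q : QuandleS Q) {n : ℕ} (c : Fin n → Q) :
    IsQuandleHom (freeQnd n) q (liftQ q c) := by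
  constructor
  · intro a b
    obtain ⟨i, u, hu⟩ := exists_conj a
    obtain ⟨j, v, hv⟩ := exists_conj b
    rw [liftQ_eq q c a i u hu, liftQ_eq q c b j v hv, ← ract_conj, ← ract_mul, ← hv]
    apply liftQ_eq
    change b.1⁻¹ * a.1 * b.1 = _
    rw [hu]; group
  · intro a b
    obtain ⟨i, u, hu⟩ := exists_conj a
    obtain ⟨j, v, hv⟩ := exists_conj b
    rw [liftQ_eq q c a i u hu, liftQ_eq q c b j v hv, ← ract_conj_inv, ← ract_mul, ← hv]
    apply liftQ_eq
    change b.1 * a.1 * b.1⁻¹ = _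
    rw [hu]; group

theorem liftQ_y {Q : Type} (q : QuandleS Q) {n : ℕ} (c : Fin n → Q) (i : Fin n) :
    liftQ q c (yQ n i) = c i := by
  rw [liftQ_eq q c (yQ n i) i 1 (by simp [yQ]), ract_one]

theorem ract_free {n : ℕ} (g : FreeQndC n) (u : FreeGroup (Fin n)) :
    (ract (freeQnd n) (yQ n) g u).1 = u⁻¹ * g.1 * u := by
  induction u using FreeGroup.induction_on generalizing g with
  | C1 => rw [ract_one]; simp
  | of i => rw [ract_of]; rfl
  | inv_of i _ => rw [ract_of_inv, inv_inv]; rfl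
  | mul g h ihg ihh => rw [ract_mul, ihh, ihg]; group

theorem free_eq {n : ℕ} (g : FreeQndC n) :
    ∃ (i : Fin n) (u : FreeGroup (Fin n)), g = ract (freeQnd n) (yQ n) (yQ n i) u := by
  obtain ⟨i, u, hu⟩ := exists_conj g
  exact ⟨i, u, Subtype.ext (by rw [ract_free, hu]; rfl)⟩

theorem hom_ext {Q : Type} (q : QuandleS Q) {n : ℕ} {f g : FreeQndC n → Q}
    (hf : IsQuandleHom (freeQnd n) q f) (hg : IsQuandleHom (freeQnd n) q g)
    (h : ∀ i, f (yQ n i) = g (yQ n i)) : f = g := by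
  funext a
  obtain ⟨i, u, rfl⟩ := free_eq a
  have hc : f ∘ yQ n = g ∘ yQ n := funext h
  rw [ract_natural _ _ q hf, ract_natural _ _ q hg, hc, h]

theorem hom_comp {A B C : Type} {a : QuandleS A} {b : QuandleS B} {c : QuandleS C}
    {f : A → B} {g : B → C} (hf : IsQuandleHom a b f) (hg : IsQuandleHom b c g) :
    IsQuandleHom a c (g ∘ f) :=
  ⟨fun x y => by simp only [Function.comp]; rw [hf.1, hg.1],
   fun x y => by simp only [Function.comp]; rw [hf.2, hg.2]⟩

/-- Inclusion `Qₙ → Qₙ₊₁`. -/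
noncomputable def inc (n : ℕ) : FreeQndC n → FreeQndC (n + 1) :=
  liftQ (freeQnd (n + 1)) (fun i => yQ (n + 1) i.castSucc)

section Test
variable (G : Type) [Group G]

/-- Right action of `G` on `G ⊕ G`: conjugation on the left copy, translation on the right. -/
def tAct : G ⊕ G → G → G ⊕ G
  | .inl k, g => .inl (g⁻¹ * k * g)
  | .inr k, g => .inr (k * g)

/-- Augmentation. -/
def tAug : G ⊕ G → G
  | .inl k => k
  | .inr _ => 1

/-- The test quandle. -/
def tQ : QuandleS (G ⊕ G) where
  act a b := tAct G a (tAug G b)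
  invAct a b := tAct G a (tAug G b)⁻¹
  self_distrib a b c := by
    rcases a with a | a <;> rcases b with b | b <;> rcases c with c | c <;>
      simp [tAct, tAug, mul_assoc]
  self_distrib_inv a b c := by
    rcases a with a | a <;> rcases b with b | b <;> rcases c with c | c <;>
      simp [tAct, tAug, mul_assoc]
  act_invAct a b := by
    rcases a with a | a <;> rcases b with b | b <;> simp [tAct, tAug, mul_assoc]
  invAct_act a b := by
    rcases a with a | a <;> rcases b with b | b <;> simp [tAct, tAug, mul_assoc]
  act_self a := by
    rcases a with a | a <;> simp [tAct, tAug, mul_assoc]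
  invAct_self a := by
    rcases a with a | a <;> simp [tAct, tAug, mul_assoc]

theorem ract_tQ {X : Type} (c : X → G ⊕ G) (x : G ⊕ G) (u : FreeGroup X) :
    ract (tQ G) c x u = tAct G x (FreeGroup.lift (fun i => tAug G (c i)) u) := by
  induction u using FreeGroup.induction_on generalizing x with
  | C1 => rw [ract_one]; rcases x with x | x <;> simp [tAct]
  | of i => rw [ract_of, FreeGroup.lift_apply_of]; rfl
  | inv_of i _ => rw [ract_of_inv, map_inv, FreeGroup.lift_apply_of]; rfl
  | mul g h ihg ihh =>
    rw [ract_mul, ihh, ihg, map_mul]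
    rcases x with x | x <;> simp [tAct, mul_assoc]

theorem tHom {n : ℕ} (φ : FreeGroup (Fin n) →* G) :
    IsQuandleHom (freeQnd n) (tQ G) (fun k => Sum.inl (φ k.1)) := by
  constructor
  · intro a b
    change Sum.inl (φ (b.1⁻¹ * a.1 * b.1)) = Sum.inl ((φ b.1)⁻¹ * φ a.1 * φ b.1)
    simp
  · intro a b
    change Sum.inl (φ (b.1 * a.1 * b.1⁻¹)) = Sum.inl ((φ b.1)⁻¹⁻¹ * φ a.1 * (φ b.1)⁻¹)
    simp
end Test

theorem ract_map {Q X Y : Type} (q : QuandleS Q) (c : Y → Q) (s : X → Y) (x : Q)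
    (u : FreeGroup X) : ract q c x (FreeGroup.map s u) = ract q (c ∘ s) x u := by
  induction u using FreeGroup.induction_on generalizing x with
  | C1 => rw [map_one, ract_one, ract_one]
  | of i => rw [FreeGroup.map.of, ract_of, ract_of]; rfl
  | inv_of i _ => rw [map_inv, FreeGroup.map.of, ract_of_inv, ract_of_inv]; rfl
  | mul g h ihg ihh => rw [map_mul, ract_mul, ract_mul, ihh, ihg]

theorem forward (n : ℕ)
    (π : ∀ (Q : Type) (q : QuandleS Q), (FreeQndC n → Q) → Q → Q)
    (hend : ∀ (Q : Type) (q : QuandleS Q) (h : FreeQndC n → Q),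
      IsQuandleHom (freeQnd n) q h → IsQuandleHom q q (π Q q h))
    (hbij : ∀ (Q : Type) (q : QuandleS Q) (h : FreeQndC n → Q),
        IsQuandleHom (freeQnd n) q h → Function.Bijective (π Q q h))
    (hnat : ∀ (Q : Type) (q : QuandleS Q) (Q' : Type) (q' : QuandleS Q')
        (h : FreeQndC n → Q) (f : Q → Q'),
        IsQuandleHom (freeQnd n) q h → IsQuandleHom q q' f →
        f ∘ π Q q h = π Q' q' (f ∘ h) ∘ f) :
    ∃ v : FreeGroup (Fin n), ∀ (Q : Type) (q : QuandleS Q) (h : FreeQndC n → Q),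
        IsQuandleHom (freeQnd n) q h → ∀ x : Q, π Q q h x = ract q (h ∘ yQ n) x v := by
  obtain ⟨j, w, ht⟩ := free_eq
    (π (FreeQndC (n + 1)) (freeQnd (n + 1)) (inc n) (yQ (n + 1) (Fin.last n)))
  have hinc : IsQuandleHom (freeQnd n) (freeQnd (n + 1)) (inc n) := liftQ_hom _ _
  have key0 : ∀ (Q : Type) (q : QuandleS Q) (h : FreeQndC n → Q),
      IsQuandleHom (freeQnd n) q h → ∀ x : Q,
      π Q q h x = liftQ q (Fin.snoc (α := fun _ => Q) (h ∘ yQ n) x)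
        (π (FreeQndC (n + 1)) (freeQnd (n + 1)) (inc n) (yQ (n + 1) (Fin.last n))) := by
    intro Q q h hh x
    have hf := liftQ_hom q (Fin.snoc (α := fun _ => Q) (h ∘ yQ n) x)
    have h1 := congrFun (hnat _ _ _ q (inc n) _ hinc hf) (yQ (n + 1) (Fin.last n))
    have h2 : liftQ q (Fin.snoc (α := fun _ => Q) (h ∘ yQ n) x) ∘ inc n = h := by
      refine hom_ext q (hom_comp hinc hf) hh fun i => ?_
      simp only [Function.comp, inc, liftQ_y, Fin.snoc_castSucc]
    rw [h2] at h1
    simp only [Function.comp, liftQ_y, Fin.snoc_last] at h1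
    exact h1.symm
  have key : ∀ (Q : Type) (q : QuandleS Q) (h : FreeQndC n → Q),
      IsQuandleHom (freeQnd n) q h → ∀ x : Q,
      π Q q h x = ract q (Fin.snoc (α := fun _ => Q) (h ∘ yQ n) x)
        (Fin.snoc (α := fun _ => Q) (h ∘ yQ n) x j) w := by
    intro Q q h hh x
    rw [key0 Q q h hh x, ht]
    exact liftQ_eq _ _ _ _ _ (by rw [ract_free]; rfl)
  let G := FreeGroup (Fin (n + 1))
  let φ : FreeGroup (Fin n) →* FreeGroup (Fin (n + 1)) := FreeGroup.map Fin.castSucc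
  let h : FreeQndC n → G ⊕ G := fun k => Sum.inl (φ k.1)
  have hh : IsQuandleHom (freeQnd n) (tQ G) h := tHom G φ
  have hy : ∀ i, h (yQ n i) = Sum.inl (FreeGroup.of i.castSucc) := fun i => by
    simp only [h, φ, yQ]; rfl
  rcases Fin.eq_castSucc_or_eq_last j with ⟨i, rfl⟩ | rfl
  · exfalso
    obtain ⟨x, hx⟩ := (hbij _ _ h hh).2 (Sum.inr 1)
    rw [key _ _ h hh, ract_tQ, Fin.snoc_castSucc, Function.comp, hy] at hx
    simp [tAct] at hx
  · simp only [Fin.snoc_last] at key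
    let v : FreeGroup (Fin n) :=
      FreeGroup.lift (Fin.snoc (α := fun _ => FreeGroup (Fin n)) FreeGroup.of 1) w
    have hv : ∀ g : G, FreeGroup.lift (fun i => tAug G
        (Fin.snoc (α := fun _ => G ⊕ G) (h ∘ yQ n) (Sum.inr g) i)) w = φ v := by
      intro g
      have : FreeGroup.lift (fun i => tAug G
          (Fin.snoc (α := fun _ => G ⊕ G) (h ∘ yQ n) (Sum.inr g) i)) =
          φ.comp (FreeGroup.lift (Fin.snoc (α := fun _ => FreeGroup (Fin n)) FreeGroup.of 1)) := by
        ext i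
        refine Fin.lastCases ?_ (fun i => ?_) i
        · simp [tAug]
        · simp [tAug, hy, φ]; try rfl
      rw [this]; rfl
    have hw : FreeGroup.lift (fun i => tAug G
        (Fin.snoc (α := fun _ => G ⊕ G) (h ∘ yQ n)
          (Sum.inl (FreeGroup.of (Fin.last n))) i)) w = w := by
      have : FreeGroup.lift (fun i => tAug G
          (Fin.snoc (α := fun _ => G ⊕ G) (h ∘ yQ n)
            (Sum.inl (FreeGroup.of (Fin.last n))) i)) = MonoidHom.id _ := by
        ext i
        refine Fin.lastCases ?_ (fun i => ?_) i
        · simp [tAug]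
        · simp [tAug, hy]
      rw [this]; rfl
    have e1 := (hend _ _ h hh).1 (Sum.inr 1) (Sum.inl (FreeGroup.of (Fin.last n)))
    have e0 : (tQ G).act (Sum.inr 1) (Sum.inl (FreeGroup.of (Fin.last n)))
        = Sum.inr (FreeGroup.of (Fin.last n)) := by
      change Sum.inr (1 * _) = _
      rw [one_mul]; rfl
    rw [e0] at e1
    simp only [key _ _ h hh, ract_tQ, hv, hw] at e1
    have e2 : FreeGroup.of (Fin.last n) * φ v
        = 1 * φ v * (w⁻¹ * FreeGroup.of (Fin.last n) * w) := Sum.inr.inj e1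
    have e3 : π (FreeQndC (n + 1)) (freeQnd (n + 1)) (inc n) (yQ (n + 1) (Fin.last n))
        = ract (freeQnd (n + 1)) (yQ (n + 1)) (yQ (n + 1) (Fin.last n)) (φ v) := by
      rw [ht]
      apply Subtype.ext
      rw [ract_free, ract_free]
      change w⁻¹ * FreeGroup.of (Fin.last n) * w = (φ v)⁻¹ * FreeGroup.of (Fin.last n) * φ v
      rw [mul_assoc (φ v)⁻¹]; refine Eq.trans ?_ (congrArg ((φ v)⁻¹ * ·) e2.symm); group
    refine ⟨v, fun Q q h' hh' x => ?_⟩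
    rw [key0 Q q h' hh' x, e3, liftQ_eq _ _ _ (Fin.last n) (φ v) (by rw [ract_free]; rfl),
      Fin.snoc_last, ract_map]
    congr 1
    funext i
    simp

end NatFam

/-- **Corollary 2.1 of the paper.** Let `π` assign to each quandle `Q` and each
quandle homomorphism `h : Qₙ → Q` a quandle endomorphism `π_h : Q → Q`.  Then
`π` is a natural family of automorphisms over `Qₙ` (each `π_h` is bijective and
`f ∘ π_h = π_{f ∘ h} ∘ f`) iff there is a unique reduced word
`y_{i₁}^{ε₁} ⋯ y_{iₘ}^{εₘ}` such that for every quandle homomorphism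
`h : Qₙ → Q` and every `x ∈ Q`,
`π_h x = x ◁^{ε₁} h(y_{i₁}) ◁^{ε₂} ⋯ ◁^{εₘ} h(y_{iₘ})` (left-associated). -/
theorem natural_family_free_quandle (n : ℕ)
    (π : ∀ (Q : Type) (q : QuandleS Q), (FreeQndC n → Q) → Q → Q)
    (hend : ∀ (Q : Type) (q : QuandleS Q) (h : FreeQndC n → Q),
      IsQuandleHom (freeQnd n) q h → IsQuandleHom q q (π Q q h)) :
    ((∀ (Q : Type) (q : QuandleS Q) (h : FreeQndC n → Q),
        IsQuandleHom (freeQnd n) q h → Function.Bijective (π Q q h)) ∧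
     (∀ (Q : Type) (q : QuandleS Q) (Q' : Type) (q' : QuandleS Q')
        (h : FreeQndC n → Q) (f : Q → Q'),
        IsQuandleHom (freeQnd n) q h → IsQuandleHom q q' f →
        f ∘ π Q q h = π Q' q' (f ∘ h) ∘ f)) ↔
    ∃! w : List (Fin n × Bool), ReducedWord w ∧
      ∀ (Q : Type) (q : QuandleS Q) (h : FreeQndC n → Q),
        IsQuandleHom (freeQnd n) q h →
        ∀ x : Q, π Q q h x = q.chainAct x (w.map fun p => (h (yQ n p.1), p.2)) := by
  constructor
  · rintro ⟨hbij, hnat⟩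
    obtain ⟨v, hv⟩ := NatFam.forward n π hend hbij hnat
    refine ⟨v.toWord, ⟨FreeGroup.isReduced_toWord, ?_⟩, ?_⟩
    · intro Q q h hh x
      rw [hv Q q h hh x]
      have := NatFam.chain_eq q (h ∘ yQ n) v.toWord x
      rw [FreeGroup.mk_toWord] at this
      exact this.symm
    · rintro w ⟨hw, hform⟩
      have hh := NatFam.tHom (FreeGroup (Fin n)) (MonoidHom.id (FreeGroup (Fin n)))
      have h1 := hform _ _ _ hh (Sum.inr 1)
      rw [hv _ _ _ hh] at h1
      have h2 := NatFam.chain_eq (NatFam.tQ (FreeGroup (Fin n)))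
        ((fun k : FreeQndC n => Sum.inl (MonoidHom.id (FreeGroup (Fin n)) k.1)) ∘ yQ n) w
        (Sum.inr 1)
      have h3 := h1.trans h2
      rw [NatFam.ract_tQ, NatFam.ract_tQ] at h3
      have h4 : FreeGroup.lift (fun i => NatFam.tAug (FreeGroup (Fin n))
          (((fun k : FreeQndC n => Sum.inl (MonoidHom.id (FreeGroup (Fin n)) k.1)) ∘ yQ n) i))
          = MonoidHom.id _ := by
        ext i
        simp [NatFam.tAug, yQ]
      rw [h4] at h3
      have h5 : 1 * v = 1 * FreeGroup.mk w := Sum.inr.inj h3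
      rw [one_mul, one_mul] at h5
      rw [h5, FreeGroup.toWord_mk, FreeGroup.IsReduced.reduce_eq hw]
  · rintro ⟨w, ⟨-, hform⟩, -⟩
    have hf : ∀ (Q : Type) (q : QuandleS Q) (h : FreeQndC n → Q),
        IsQuandleHom (freeQnd n) q h →
        π Q q h = fun x => NatFam.ract q (h ∘ yQ n) x (FreeGroup.mk w) := by
      intro Q q h hh
      funext x
      rw [hform Q q h hh x]
      exact NatFam.chain_eq q (h ∘ yQ n) w x
    refine ⟨fun Q q h hh => ?_, fun Q q Q' q' h f hh hff => ?_⟩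
    · rw [hf Q q h hh]
      exact NatFam.ract_bij _ _ _
    · rw [hf Q q h hh, hf Q' q' _ (NatFam.hom_comp hh hff)]
      funext x
      exact NatFam.ract_natural _ _ q' hff _ _
end

section
/- Let n ≥ 0 and let h : Q_n → Q_n be a quandle endomorphism of the free quandle on n generators. Then h is a categorical inner automorphism if and only if h is an algebraic inner automorphism, i.e. there exist m ≥ 0, elements q_1, …, q_m ∈ Q_n and signs ε_1, …, ε_m ∈ {1, −1} such that h(q) = q ◁^{ε_1} q_1 ◁^{ε_2} … ◁^{ε_m} q_m (left-associated) for all q ∈ Q_n. -/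
section Helpers

lemma chain_append {α : Type} (q : RackS α) (l l' : List (α × Bool)) (a : α) :
    q.chainAct a (l ++ l') = q.chainAct (q.chainAct a l) l' := by
  induction l generalizing a with
  | nil => rfl
  | cons p l ih => simp only [List.cons_append, RackS.chainAct, ih]

/-- One step of a chain. -/
def stepAct {α : Type} (q : RackS α) (p : α × Bool) (a : α) : α :=
  if p.2 then q.act a p.1 else q.invAct a p.1

lemma chain_cons {α : Type} (q : RackS α) (p : α × Bool) (l : List (α × Bool)) (a : α) :
    q.chainAct a (p :: l) = q.chainAct (stepAct q p a) l := rfl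

lemma act_inj {α : Type} (q : RackS α) {a b c : α} (h : q.act a c = q.act b c) : a = b := by
  rw [← q.act_invAct a c, h, q.act_invAct]

lemma invAct_inj {α : Type} (q : RackS α) {a b c : α} (h : q.invAct a c = q.invAct b c) :
    a = b := by
  rw [← q.invAct_act a c, h, q.invAct_act]

lemma step_hom {α : Type} (q : RackS α) (p : α × Bool) : IsRackHom q q (stepAct q p) := by
  obtain ⟨c, b⟩ := p
  cases b
  · refine ⟨fun x y => ?_, fun x y => ?_⟩
    · simp only [stepAct, Bool.false_eq_true, if_false]
      apply act_inj q (c := c)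
      rw [q.self_distrib, q.invAct_act, q.invAct_act, q.invAct_act]
    · simp only [stepAct, Bool.false_eq_true, if_false]
      exact q.self_distrib_inv x y c
  · refine ⟨fun x y => ?_, fun x y => ?_⟩
    · simp only [stepAct, if_true]
      exact q.self_distrib x y c
    · simp only [stepAct, if_true]
      apply invAct_inj q (c := c)
      rw [q.self_distrib_inv, q.act_invAct, q.act_invAct, q.act_invAct]

lemma step_bij {α : Type} (q : RackS α) (p : α × Bool) : Function.Bijective (stepAct q p) := by
  obtain ⟨c, b⟩ := p
  cases b
  · refine ⟨fun x y h => ?_, fun x => ⟨q.act x c, ?_⟩⟩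
    · exact invAct_inj q (by simpa [stepAct] using h)
    · simp [stepAct, q.act_invAct]
  · refine ⟨fun x y h => ?_, fun x => ⟨q.invAct x c, ?_⟩⟩
    · exact act_inj q (by simpa [stepAct] using h)
    · simp [stepAct, q.invAct_act]

lemma chain_hom_bij {α : Type} (q : RackS α) (l : List (α × Bool)) :
    IsRackHom q q (fun a => q.chainAct a l) ∧ Function.Bijective (fun a => q.chainAct a l) := by
  induction l with
  | nil => exact ⟨⟨fun _ _ => rfl, fun _ _ => rfl⟩, Function.bijective_id⟩
  | cons p l ih =>
    obtain ⟨⟨h1, h2⟩, h3⟩ := ih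
    obtain ⟨s1, s2⟩ := step_hom q p
    refine ⟨⟨fun a b => ?_, fun a b => ?_⟩, ?_⟩
    · simp only [chain_cons, s1]; exact h1 _ _
    · simp only [chain_cons, s2]; exact h2 _ _
    · exact h3.comp (step_bij q p)

lemma hom_chain {α β : Type} (q : RackS α) (q' : RackS β) (f : α → β) (hf : IsRackHom q q' f)
    (l : List (α × Bool)) (a : α) :
    f (q.chainAct a l) = q'.chainAct (f a) (l.map fun p => (f p.1, p.2)) := by
  induction l generalizing a with
  | nil => rfl
  | cons p l ih =>
    obtain ⟨c, b⟩ := p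
    rw [List.map_cons, chain_cons, chain_cons, ih]
    cases b
    · simp [stepAct, hf.2]
    · simp [stepAct, hf.1]

lemma exists_chain (n : ℕ) (g : FreeGroup (Fin n)) :
    ∃ l : List (FreeQndC n × Bool), ∀ q : FreeQndC n,
      ((freeQnd n).chainAct q l).1 = g⁻¹ * q.1 * g := by
  induction g using FreeGroup.induction_on with
  | C1 => exact ⟨[], fun q => by simp [RackS.chainAct]⟩
  | of i => exact ⟨[(yQ n i, true)], fun q => rfl⟩
  | inv_of i _ =>
    exact ⟨[(yQ n i, false)], fun q => by
      show FreeGroup.of i * q.1 * (FreeGroup.of i)⁻¹ = (FreeGroup.of i)⁻¹⁻¹ * q.1 * (FreeGroup.of i)⁻¹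
      rw [inv_inv]⟩
  | mul x y hx hy =>
    obtain ⟨l, hl⟩ := hx
    obtain ⟨l', hl'⟩ := hy
    refine ⟨l ++ l', fun q => ?_⟩
    rw [chain_append, hl', hl]
    group

/-- The quandle `Qₙ ⊔ F`, where `F` is a torsor for the translation action of `Qₙ`. -/
def bigQ (n : ℕ) : QuandleS (FreeQndC n ⊕ FreeGroup (Fin n)) where
  act
    | .inl a, .inl b => .inl ((freeQnd n).act a b)
    | .inl a, .inr _ => .inl a
    | .inr x, .inl b => .inr (x * b.1)
    | .inr x, .inr _ => .inr x
  invAct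
    | .inl a, .inl b => .inl ((freeQnd n).invAct a b)
    | .inl a, .inr _ => .inl a
    | .inr x, .inl b => .inr (x * b.1⁻¹)
    | .inr x, .inr _ => .inr x
  self_distrib := by
    rintro (a | a) (b | b) (c | c)
    · exact congrArg Sum.inl ((freeQnd n).self_distrib a b c)
    all_goals simp [freeQnd, mul_assoc]
  self_distrib_inv := by
    rintro (a | a) (b | b) (c | c)
    · exact congrArg Sum.inl ((freeQnd n).self_distrib_inv a b c)
    all_goals simp [freeQnd, mul_assoc]
  act_invAct := by
    rintro (a | a) (b | b) <;> simp [(freeQnd n).act_invAct]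
  invAct_act := by
    rintro (a | a) (b | b) <;> simp [(freeQnd n).invAct_act]
  act_self := by
    rintro (a | a) <;> simp [(freeQnd n).act_self]
  invAct_self := by
    rintro (a | a) <;> simp [(freeQnd n).invAct_self]

/-- Left translation on the torsor part. -/
def leftT (n : ℕ) (u : FreeGroup (Fin n)) :
    FreeQndC n ⊕ FreeGroup (Fin n) → FreeQndC n ⊕ FreeGroup (Fin n)
  | .inl a => .inl a
  | .inr x => .inr (u * x)

lemma leftT_hom (n : ℕ) (u : FreeGroup (Fin n)) : IsQuandleHom (bigQ n) (bigQ n) (leftT n u) := by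
  constructor
  · rintro (a | a) (b | b) <;> simp [bigQ, leftT, mul_assoc]
  · rintro (a | a) (b | b) <;> simp [bigQ, leftT, mul_assoc]

lemma inl_hom (n : ℕ) : IsQuandleHom (freeQnd n) (bigQ n) Sum.inl :=
  ⟨fun _ _ => rfl, fun _ _ => rfl⟩

lemma ne_one (n : ℕ) (q : FreeQndC n) : q.1 ≠ 1 := by
  obtain ⟨g, i, hi⟩ := q
  rintro rfl
  exact FreeGroup.of_ne_one i (isConj_one_left.1 hi)

end Helpers

/-- **Corollary 2.3 of the paper.** Let `h : Qₙ → Qₙ` be a quandle endomorphism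
of the free quandle on `n` generators.  Then `h` is a categorical inner
automorphism iff `h` is an algebraic inner automorphism, i.e. there are
`m ≥ 0`, elements `q₁, …, qₘ ∈ Qₙ` and signs `ε₁, …, εₘ` (i.e. a list `l` of
pairs) such that `h q = q ◁^{ε₁} q₁ ◁^{ε₂} ⋯ ◁^{εₘ} qₘ` (left-associated) for
all `q ∈ Qₙ`. -/
theorem cat_inner_iff_alg_inner_free_quandle (n : ℕ) (h : FreeQndC n → FreeQndC n)
    (hh : IsQuandleHom (freeQnd n) (freeQnd n) h) :
    IsCatInnerQ n h ↔
      ∃ l : List (FreeQndC n × Bool),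
        ∀ q : FreeQndC n, h q = (freeQnd n).chainAct q l := by
  constructor
  · rintro ⟨π, ⟨h1, h2⟩, rfl⟩
    obtain ⟨⟨p1, -⟩, pinj, -⟩ := h1 _ (bigQ n) Sum.inl (inl_hom n)
    have e1 : ∀ a, π _ (bigQ n) Sum.inl (Sum.inl a) = Sum.inl (π _ (freeQnd n) id a) := fun a =>
      (congrFun (h2 _ (freeQnd n) _ (bigQ n) id Sum.inl
        ⟨fun _ _ => rfl, fun _ _ => rfl⟩ (inl_hom n)) a).symm
    have e2 : ∀ u x, leftT n u (π _ (bigQ n) Sum.inl x) = π _ (bigQ n) Sum.inl (leftT n u x) :=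
      fun u x => congrFun (h2 _ (bigQ n) _ (bigQ n) Sum.inl (leftT n u)
        (inl_hom n) (leftT_hom n u)) x
    rcases hg : π _ (bigQ n) Sum.inl (Sum.inr 1) with q | g
    · exfalso
      have := e2 q.1 (Sum.inr 1)
      rw [hg] at this
      have h3 : leftT n q.1 (Sum.inr 1) = Sum.inr 1 := pinj (by rw [← this, hg]; rfl)
      simp only [leftT, mul_one] at h3
      exact ne_one n q (Sum.inr.inj h3)
    · obtain ⟨l, hl⟩ := exists_chain n g
      refine ⟨l, fun q => Subtype.ext ?_⟩
      rw [hl]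
      have h3 := p1 (Sum.inr 1) (Sum.inl q)
      rw [hg, e1] at h3
      have h4 := e2 q.1 (Sum.inr 1)
      rw [hg] at h4
      have h5 : (bigQ n).act (Sum.inr 1) (Sum.inl q) = leftT n q.1 (Sum.inr 1) := by
        simp [bigQ, leftT]
      rw [h5, ← h4] at h3
      have h6 : q.1 * g = g * (π _ (freeQnd n) id q).1 := Sum.inr.inj h3
      rw [mul_assoc, h6, inv_mul_cancel_left]
  · rintro ⟨l, hl⟩
    refine ⟨fun Q q k x => q.chainAct x (l.map fun p => (k p.1, p.2)), ⟨?_, ?_⟩, ?_⟩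
    · intro Q q k hk
      exact chain_hom_bij q.toRackS _
    · intro Q q Q' q' k f hk hf
      funext x
      show f (q.chainAct x _) = q'.chainAct (f x) _
      rw [hom_chain q.toRackS q'.toRackS f hf, List.map_map]
      rfl
    · funext x
      simp [hl]
end

section
/- The global isotropy group of the category of quandles is trivial: if φ assigns to every quandle Q a bijective quandle endomorphism φ_Q : Q → Q such that f ∘ φ_Q = φ_{Q'} ∘ f for every quandle homomorphism f : Q → Q', then φ_Q is the identity map for every quandle Q. -/
/-- **The global isotropy group of the category of quandles is trivial**
(Corollary 3 of the paper): if `φ` assigns to every quandle `Q` a bijective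
quandle endomorphism `φ_Q : Q → Q` naturally in `Q` (that is,
`f ∘ φ_Q = φ_{Q'} ∘ f` for every quandle homomorphism `f : Q → Q'`), then every
`φ_Q` is the identity map. -/
theorem global_isotropy_quandle_trivial
    (φ : ∀ (Q : Type) (q : QuandleS Q), Q → Q)
    (hend : ∀ (Q : Type) (q : QuandleS Q), IsQuandleHom q q (φ Q q))
    (hbij : ∀ (Q : Type) (q : QuandleS Q), Function.Bijective (φ Q q))
    (hnat : ∀ (Q : Type) (q : QuandleS Q) (Q' : Type) (q' : QuandleS Q') (f : Q → Q'),
      IsQuandleHom q q' f → f ∘ φ Q q = φ Q' q' ∘ f) :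
    ∀ (Q : Type) (q : QuandleS Q) (x : Q), φ Q q x = x := by
  intro Q q x
  let u : QuandleS Unit :=
    { act := fun _ _ => ()
      invAct := fun _ _ => ()
      self_distrib := fun _ _ _ => rfl
      self_distrib_inv := fun _ _ _ => rfl
      act_invAct := fun _ _ => rfl
      invAct_act := fun _ _ => rfl
      act_self := fun _ => rfl
      invAct_self := fun _ => rfl }
  have h := hnat Unit u Q q (fun _ => x)
    ⟨fun _ _ => (q.act_self x).symm, fun _ _ => (q.invAct_self x).symm⟩
  exact (congrFun h ()).symm
end

section
/- Let n ≥ 0 and let π be an assignment, to each rack R and each rack homomorphism h : R_n → R, of a rack endomorphism π_h : R → R. Then π is a natural family of automorphisms over R_n (each π_h is bijective and f ∘ π_h = π_{f∘h} ∘ f for all rack homomorphisms h : R_n → R and f : R → R') if and only if there exist a unique integer z ∈ ℤ and a unique reduced word y_{i_1}^{ε_1} ⋯ y_{i_m}^{ε_m} over the generators y_1, …, y_n such that for every rack homomorphism h : R_n → R and every r ∈ R, π_h(r) = r ◁^{δ_1} r ◁^{δ_2} … ◁^{δ_{|z|}} r ◁^{ε_1} h(y_{i_1}) ◁^{ε_2}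 … ◁^{ε_m} h(y_{i_m}) (left-associated), where δ_1 = … = δ_{|z|} = 1 if z > 0 and δ_1 = … = δ_{|z|} = −1 if z < 0. -/
/-- The carrier of the free rack `Rₙ` on `n` generators:
`Fin n × FreeGroup (Fin n)`. -/
def FreeRckC (n : ℕ) : Type := Fin n × FreeGroup (Fin n)

/-- The free rack `Rₙ` on `n` generators, with operations
`(a, s) ◁ (b, t) = (a, s·t⁻¹·b·t)` and `(a, s) ◁⁻¹ (b, t) = (a, s·t⁻¹·b⁻¹·t)`. -/
def freeRck (n : ℕ) : RackS (FreeRckC n) where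
  act a b := (a.1, a.2 * b.2⁻¹ * FreeGroup.of b.1 * b.2)
  invAct a b := (a.1, a.2 * b.2⁻¹ * (FreeGroup.of b.1)⁻¹ * b.2)
  self_distrib a b c := Prod.ext rfl (by show _ * _ * _ * _ = _ * _ * _ * _; group)
  self_distrib_inv a b c := Prod.ext rfl (by show _ * _ * _ * _ = _ * _ * _ * _; group)
  act_invAct a b := Prod.ext rfl (by show _ * _ * _ * _ = _; group)
  invAct_act a b := Prod.ext rfl (by show _ * _ * _ * _ = _; group)

/-- The generator `yᵢ = (i, 1)` of the free rack `Rₙ`. -/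
def yR (n : ℕ) (i : Fin n) : FreeRckC n := (i, 1)

/-- A natural family of automorphisms over the free rack `Rₙ`: an assignment,
to each rack `R` and each rack homomorphism `h : Rₙ → R`, of a bijective rack
endomorphism `π_h : R → R`, natural in the sense that
`f ∘ π_h = π_{f ∘ h} ∘ f` for all rack homomorphisms `h : Rₙ → R` and
`f : R → R'`. -/
def IsNaturalFamilyR (n : ℕ)
    (π : ∀ (R : Type) (q : RackS R), (FreeRckC n → R) → R → R) : Prop :=
  (∀ (R : Type) (q : RackS R) (h : FreeRckC n → R), IsRackHom (freeRck n) q h →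
      IsRackHom q q (π R q h) ∧ Function.Bijective (π R q h)) ∧
  (∀ (R : Type) (q : RackS R) (R' : Type) (q' : RackS R')
      (h : FreeRckC n → R) (f : R → R'),
      IsRackHom (freeRck n) q h → IsRackHom q q' f →
      f ∘ π R q h = π R' q' (f ∘ h) ∘ f)

/-- An endomorphism `h₀ : Rₙ → Rₙ` is a categorical inner automorphism iff some
natural family of automorphisms `π` over `Rₙ` satisfies `π_{id} = h₀`. -/
def IsCatInnerR (n : ℕ) (h0 : FreeRckC n → FreeRckC n) : Prop :=
  ∃ π, IsNaturalFamilyR n π ∧ π (FreeRckC n) (freeRck n) id = h0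

/-! ### Centralizer of a generator in a free group -/

theorem aux_centralizer {A : Type} [DecidableEq A] (x : A) :
    ∀ L : List (A × Bool), FreeGroup.IsReduced L →
      FreeGroup.of x * FreeGroup.mk L = FreeGroup.mk L * FreeGroup.of x →
      ∃ z : ℤ, FreeGroup.mk L = FreeGroup.of x ^ z := by
  intro L
  induction L with
  | nil => intro _ _; exact ⟨0, by simp [FreeGroup.one_eq_mk]⟩
  | cons p L ih =>
    obtain ⟨a, b⟩ := p
    intro hred hc
    have hL : FreeGroup.IsReduced L := List.IsChain.tail hred
    have hsplit : FreeGroup.mk ((a, b) :: L) = FreeGroup.mk [(a, b)] * FreeGroup.mk L := by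
      simp [FreeGroup.mul_mk]
    by_cases hax : a = x
    · subst hax
      have hone : ∃ e : ℤ, FreeGroup.mk [(a, b)] = FreeGroup.of a ^ e := by
        cases b
        · exact ⟨-1, by simp [FreeGroup.of, FreeGroup.inv_mk, FreeGroup.invRev]⟩
        · exact ⟨1, by simp [FreeGroup.of]⟩
      obtain ⟨e, he⟩ := hone
      rw [hsplit, he] at hc
      have hc' : FreeGroup.of a * FreeGroup.mk L = FreeGroup.mk L * FreeGroup.of a := by
        have h1 : FreeGroup.of a ^ e * (FreeGroup.of a * FreeGroup.mk L) =
            FreeGroup.of a ^ e * (FreeGroup.mk L * FreeGroup.of a) := by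
          rw [← mul_assoc, ← mul_assoc, ← hc, ← mul_assoc]
          congr 1
          exact ((Commute.refl (FreeGroup.of a)).zpow_left e).eq
        exact mul_left_cancel h1
      obtain ⟨z, hz⟩ := ih hL hc'
      exact ⟨e + z, by rw [hsplit, he, hz, zpow_add]⟩
    · exfalso
      have h1 : (FreeGroup.of x * FreeGroup.mk ((a, b) :: L)).toWord = (x, true) :: (a, b) :: L := by
        have : FreeGroup.of x * FreeGroup.mk ((a, b) :: L)
            = FreeGroup.mk ((x, true) :: (a, b) :: L) := by
          simp [FreeGroup.of, FreeGroup.mul_mk]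
        rw [this, FreeGroup.toWord_mk]
        apply FreeGroup.IsReduced.reduce_eq
        rw [FreeGroup.isReduced_cons_cons]
        exact ⟨fun h => absurd h.symm hax, hred⟩
      have h2 := FreeGroup.toWord_mul_sublist (FreeGroup.mk ((a, b) :: L)) (FreeGroup.of x)
      rw [← hc, h1, FreeGroup.toWord_mk, hred.reduce_eq, FreeGroup.toWord_of] at h2
      have h3 := h2.eq_of_length (by simp)
      simp at h3
      exact hax h3.1.1.symm

theorem aux_centralizer' {A : Type} [DecidableEq A] (x : A) (g : FreeGroup A)
    (h : FreeGroup.of x * g = g * FreeGroup.of x) : ∃ z : ℤ, g = FreeGroup.of x ^ z := by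
  have := aux_centralizer x g.toWord FreeGroup.isReduced_toWord
  rw [FreeGroup.mk_toWord] at this
  exact this h

/-! ### Translations of a rack -/

/-- The right translation by `b`. -/
def rTrans {R : Type} (q : RackS R) (b : R) : Equiv.Perm R where
  toFun a := q.act a b
  invFun a := q.invAct a b
  left_inv a := q.act_invAct a b
  right_inv a := q.invAct_act a b

/-- Permutations compatible with translations (i.e. automorphisms). -/
def rAut {R : Type} (q : RackS R) : Subgroup (Equiv.Perm R) where
  carrier := {g | ∀ r, rTrans q (g r) = g * rTrans q r * g⁻¹}
  one_mem' := by intro r; simp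
  mul_mem' := by
    intro a b ha hb r
    have h1 := ha (b r)
    have h2 := hb r
    rw [Equiv.Perm.mul_apply, h1, h2]
    group
  inv_mem' := by
    intro a ha r
    have h1 := ha (a⁻¹ r)
    have h2 : a (a⁻¹ r) = r := a.apply_symm_apply r
    rw [h2] at h1
    rw [h1]
    group

theorem rTrans_mem {R : Type} (q : RackS R) (b : R) : rTrans q b ∈ rAut q := by
  intro r
  rw [eq_mul_inv_iff_mul_eq]
  ext a
  exact (q.self_distrib a r b).symm

/-- The (right) evaluation of a free group element, given values of the generators. -/
def evalP {A R : Type} (q : RackS R) (v : A → R) (s : FreeGroup A) : Equiv.Perm R :=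
  (FreeGroup.lift (fun a => (rTrans q (v a))⁻¹) s)⁻¹

theorem evalP_mul {A R : Type} (q : RackS R) (v : A → R) (s t : FreeGroup A) :
    evalP q v (s * t) = evalP q v t * evalP q v s := by
  simp [evalP]

theorem evalP_one {A R : Type} (q : RackS R) (v : A → R) : evalP q v 1 = 1 := by
  simp [evalP]

theorem evalP_inv {A R : Type} (q : RackS R) (v : A → R) (s : FreeGroup A) :
    evalP q v s⁻¹ = (evalP q v s)⁻¹ := by
  simp [evalP]

theorem evalP_of {A R : Type} (q : RackS R) (v : A → R) (a : A) :
    evalP q v (FreeGroup.of a) = rTrans q (v a) := by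
  simp [evalP]

theorem evalP_mem {A R : Type} (q : RackS R) (v : A → R) (s : FreeGroup A) :
    evalP q v s ∈ rAut q := by
  induction s using FreeGroup.induction_on with
  | C1 => rw [evalP_one]; exact one_mem _
  | of a => rw [evalP_of]; exact rTrans_mem q _
  | inv_of a h => rw [evalP_inv]; exact inv_mem h
  | mul a b ha hb => rw [evalP_mul]; exact mul_mem hb ha

theorem evalP_map {A B R : Type} (q : RackS R) (v : B → R) (f : A → B) (s : FreeGroup A) :
    evalP q v (FreeGroup.map f s) = evalP q (v ∘ f) s := by
  induction s using FreeGroup.induction_on with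
  | C1 => simp [evalP_one]
  | of a => simp [evalP_of]
  | inv_of a h => rw [map_inv, evalP_inv, evalP_inv, h]
  | mul a b ha hb => rw [map_mul, evalP_mul, evalP_mul, ha, hb]

theorem chainAct_eval {A R : Type} (q : RackS R) (v : A → R) (L : List (A × Bool)) :
    ∀ r : R, q.chainAct r (L.map fun p => (v p.1, p.2)) = evalP q v (FreeGroup.mk L) r := by
  induction L with
  | nil => intro r; rw [← FreeGroup.one_eq_mk, evalP_one]; rfl
  | cons p L ih =>
    intro r
    obtain ⟨a, b⟩ := p
    have hsplit : FreeGroup.mk ((a, b) :: L) = FreeGroup.mk [(a, b)] * FreeGroup.mk L := by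
      simp [FreeGroup.mul_mk]
    rw [hsplit, evalP_mul, Equiv.Perm.mul_apply, List.map_cons, RackS.chainAct, ih]
    congr 1
    cases b
    · have : FreeGroup.mk [(a, false)] = (FreeGroup.of a)⁻¹ := by
        simp [FreeGroup.of, FreeGroup.inv_mk, FreeGroup.invRev]
      rw [this, evalP_inv, evalP_of]
      rfl
    · have : FreeGroup.mk [(a, true)] = FreeGroup.of a := rfl
      rw [this, evalP_of]
      rfl

theorem hom_chainAct {R S : Type} (q : RackS R) (q' : RackS S) (f : R → S)
    (hf : IsRackHom q q' f) (L : List (R × Bool)) :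
    ∀ r : R, f (q.chainAct r L) = q'.chainAct (f r) (L.map fun p => (f p.1, p.2)) := by
  induction L with
  | nil => intro r; rfl
  | cons p L ih =>
    intro r
    obtain ⟨a, b⟩ := p
    rw [RackS.chainAct, ih, List.map_cons, RackS.chainAct]
    cases b
    · simp [hf.2]
    · simp [hf.1]

/-! ### Racks `A × G` -/

/-- The rack `A × G` attached to a map `φ : A → G`. -/
def augRack {A G : Type} [Group G] (φ : A → G) : RackS (A × G) where
  act a b := (a.1, a.2 * b.2⁻¹ * φ b.1 * b.2)
  invAct a b := (a.1, a.2 * b.2⁻¹ * (φ b.1)⁻¹ * b.2)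
  self_distrib a b c := Prod.ext rfl (by dsimp only; group)
  self_distrib_inv a b c := Prod.ext rfl (by dsimp only; group)
  act_invAct a b := Prod.ext rfl (by dsimp only; group)
  invAct_act a b := Prod.ext rfl (by dsimp only; group)

theorem augRack_hom {A B G H : Type} [Group G] [Group H] (φ : A → G) (φ' : B → H)
    (val : A → B) (t : A → H) (ψ : G →* H)
    (hψ : ∀ a, ψ (φ a) = (t a)⁻¹ * φ' (val a) * t a) :
    IsRackHom (augRack φ) (augRack φ') (fun p => (val p.1, t p.1 * ψ p.2)) := by
  constructor
  · intro a b
    refine Prod.ext rfl ?_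
    simp only [augRack, map_mul, map_inv, hψ]
    group
  · intro a b
    refine Prod.ext rfl ?_
    simp only [augRack, map_mul, map_inv, hψ]
    group

theorem augRack_chain {A : Type} (a : A) (L : List (A × Bool)) : ∀ t : FreeGroup A,
    (augRack (FreeGroup.of : A → FreeGroup A)).chainAct (a, t)
      (L.map fun p => ((p.1, 1), p.2)) = (a, t * FreeGroup.mk L) := by
  induction L with
  | nil => intro t; rw [← FreeGroup.one_eq_mk, mul_one]; rfl
  | cons p L ih =>
    intro t
    obtain ⟨c, b⟩ := p
    have hsplit : FreeGroup.mk ((c, b) :: L) = FreeGroup.mk [(c, b)] * FreeGroup.mk L := by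
      simp [FreeGroup.mul_mk]
    rw [List.map_cons, RackS.chainAct, hsplit, ← mul_assoc]
    cases b
    · have : FreeGroup.mk [(c, false)] = (FreeGroup.of c)⁻¹ := by
        simp [FreeGroup.of, FreeGroup.inv_mk, FreeGroup.invRev]
      rw [this, ← ih]
      simp [augRack]
    · have : FreeGroup.mk [(c, true)] = FreeGroup.of c := rfl
      rw [this, ← ih]
      simp [augRack]

/-- The universal evaluation is a homomorphism. -/
theorem eval_hom {A R : Type} (q : RackS R) (v : A → R) :
    IsRackHom (augRack (FreeGroup.of : A → FreeGroup A)) q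
      (fun p => evalP q v p.2 (v p.1)) := by
  constructor
  · rintro ⟨a, s⟩ ⟨b, t⟩
    have h := evalP_mem q v t (v b)
    have h2 := congrArg (fun g : Equiv.Perm R => g (evalP q v s (v a))) h
    simp only [augRack, evalP_mul, evalP_inv, evalP_of]
    exact h2.symm
  · rintro ⟨a, s⟩ ⟨b, t⟩
    have h := congrArg (·⁻¹) (evalP_mem q v t (v b))
    simp only [mul_inv_rev, inv_inv] at h
    have h2 := congrArg (fun g : Equiv.Perm R => g (evalP q v s (v a))) h
    simp only [augRack, evalP_mul, evalP_inv, evalP_of]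
    exact h2.symm

/-- A homomorphism out of the free rack is determined by its generators. -/
theorem free_hom_eq {n : ℕ} {R : Type} (q : RackS R) (h : FreeRckC n → R)
    (hh : IsRackHom (freeRck n) q h) (i : Fin n) (s : FreeGroup (Fin n)) :
    h (i, s) = evalP q (fun j => h (yR n j)) s (h (yR n i)) := by
  have h1 := augRack_chain i s.toWord 1
  rw [FreeGroup.mk_toWord, one_mul] at h1
  have h2 := hom_chainAct (freeRck n) q h hh
    (s.toWord.map fun p => ((p.1, 1), p.2)) (i, 1)
  rw [List.map_map] at h2
  have h3 := chainAct_eval q (fun j => h (yR n j)) s.toWord (h (yR n i))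
  rw [FreeGroup.mk_toWord] at h3
  rw [← h3]
  refine Eq.trans ?_ h2
  exact congrArg h h1.symm

/-- The word attached to `(z, w)`. -/
def zwWord {n : ℕ} (z : ℤ) (w : List (Fin n × Bool)) : List (Option (Fin n) × Bool) :=
  List.replicate z.natAbs (none, decide (0 < z)) ++ w.map fun p => (some p.1, p.2)

theorem mk_replicate_zpow {A : Type} (x : A) (z : ℤ) :
    FreeGroup.mk (List.replicate z.natAbs (x, decide (0 < z))) = FreeGroup.of x ^ z := by
  have hp : ∀ (k : ℕ) (b : Bool),
      FreeGroup.mk (List.replicate k (x, b)) = FreeGroup.mk [(x, b)] ^ k := by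
    intro k b
    induction k with
    | zero => simp [FreeGroup.one_eq_mk]
    | succ k ih =>
      rw [pow_succ', ← ih, FreeGroup.mul_mk]; rfl
  rw [hp]
  rcases lt_or_ge 0 z with hz | hz
  · have : z = (z.natAbs : ℤ) := by omega
    conv_rhs => rw [this, zpow_natCast]
    simp [hz, FreeGroup.of]
  · have : z = -(z.natAbs : ℤ) := by omega
    conv_rhs => rw [this, zpow_neg, zpow_natCast, ← inv_pow]
    simp [not_lt.mpr hz, FreeGroup.of, FreeGroup.inv_mk, FreeGroup.invRev]

theorem mk_zwWord {n : ℕ} (z : ℤ) (w : List (Fin n × Bool)) :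
    FreeGroup.mk (zwWord z w) =
      FreeGroup.of none ^ z * FreeGroup.map some (FreeGroup.mk w) := by
  rw [zwWord, ← FreeGroup.mul_mk, mk_replicate_zpow, FreeGroup.map.mk]

/-- Values of generators: `r` on `none`, `h(y_i)` on `some i`. -/
def gval {n : ℕ} {R : Type} (h : FreeRckC n → R) (r : R) : Option (Fin n) → R
  | none => r
  | some i => h (yR n i)

theorem chain_list_eq {n : ℕ} {R : Type} (h : FreeRckC n → R) (r : R) (z : ℤ)
    (w : List (Fin n × Bool)) :
    (List.replicate z.natAbs (r, decide (0 < z)) ++ w.map fun p => (h (yR n p.1), p.2)) =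
      (zwWord z w).map fun p => (gval h r p.1, p.2) := by
  simp [zwWord, gval, Function.comp_def]

theorem evalP_zpow_of {A R : Type} (q : RackS R) (v : A → R) (a : A) (z : ℤ) :
    evalP q v (FreeGroup.of a ^ z) = rTrans q (v a) ^ z := by
  simp [evalP]

theorem chain_eq {n : ℕ} {R : Type} (q : RackS R) (h : FreeRckC n → R) (r : R) (z : ℤ)
    (w : List (Fin n × Bool)) :
    q.chainAct r (List.replicate z.natAbs (r, decide (0 < z)) ++
        w.map fun p => (h (yR n p.1), p.2)) =
      evalP q (fun i => h (yR n i)) (FreeGroup.mk w) ((rTrans q r ^ z) r) := by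
  rw [chain_list_eq, chainAct_eval, mk_zwWord, evalP_mul, evalP_map, Equiv.Perm.mul_apply,
    evalP_zpow_of]
  rfl

theorem twist_inv {R : Type} (q : RackS R) (z : ℤ) (r : R) :
    (rTrans q ((rTrans q r ^ z) r) ^ (-z)) ((rTrans q r ^ z) r) = r := by
  have h : rTrans q ((rTrans q r ^ z) r) = rTrans q r := by
    rw [zpow_mem (rTrans_mem q r) z r]
    group
  rw [h, ← Equiv.Perm.mul_apply, ← zpow_add]
  simp

theorem twist_bij {R : Type} (q : RackS R) (z : ℤ) :
    Function.Bijective (fun r => (rTrans q r ^ z) r) := by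
  refine Function.bijective_iff_has_inverse.mpr ⟨fun r => (rTrans q r ^ (-z)) r, ?_, ?_⟩
  · intro r; exact twist_inv q z r
  · intro r
    have := twist_inv q (-z) r
    rwa [neg_neg] at this

/-- The inclusion of `Rₙ` into the free rack with one more generator. -/
def incl (n : ℕ) (p : FreeRckC n) : Option (Fin n) × FreeGroup (Option (Fin n)) :=
  (some p.1, FreeGroup.map some p.2)

theorem incl_hom (n : ℕ) : IsRackHom (freeRck n)
    (augRack (FreeGroup.of : Option (Fin n) → _)) (incl n) := by
  constructor
  · intro a b
    refine Prod.ext rfl ?_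
    simp [incl, augRack, freeRck]
  · intro a b
    refine Prod.ext rfl ?_
    simp [incl, augRack, freeRck]

/-- The retraction killing `none`. -/
def retr (n : ℕ) : FreeGroup (Option (Fin n)) →* FreeGroup (Fin n) :=
  FreeGroup.lift fun a => a.elim 1 FreeGroup.of

theorem retr_map (n : ℕ) (s : FreeGroup (Fin n)) : retr n (FreeGroup.map some s) = s := by
  have : (retr n).comp (FreeGroup.map some) = MonoidHom.id _ := by
    ext i; simp [retr]
  exact DFunLike.congr_fun this s

/-- Evaluating the universal element. -/
theorem family_eval {n : ℕ} (π : ∀ (R : Type) (q : RackS R), (FreeRckC n → R) → R → R)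
    (hnat : ∀ (R : Type) (q : RackS R) (R' : Type) (q' : RackS R')
        (h : FreeRckC n → R) (f : R → R'),
        IsRackHom (freeRck n) q h → IsRackHom q q' f →
        f ∘ π R q h = π R' q' (f ∘ h) ∘ f)
    (R : Type) (q : RackS R) (h : FreeRckC n → R) (hh : IsRackHom (freeRck n) q h) (r : R) :
    π R q h r = (fun p => evalP q (gval h r) p.2 (gval h r p.1))
      (π _ (augRack (FreeGroup.of : Option (Fin n) → _)) (incl n) (none, 1)) := by
  have h1 := hnat _ _ R q (incl n) _ (incl_hom n) (eval_hom q (gval h r))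
  have h2 : (fun p : Option (Fin n) × FreeGroup (Option (Fin n)) =>
      evalP q (gval h r) p.2 (gval h r p.1)) ∘ incl n = h := by
    funext p
    obtain ⟨i, s⟩ := p
    rw [free_hom_eq q h hh i s]
    change evalP q (gval h r) (FreeGroup.map some s) (h (yR n i)) = _
    rw [evalP_map]
    rfl
  rw [h2] at h1
  have h3 := congrFun h1 (none, 1)
  simp only [Function.comp_apply, evalP_one, Equiv.Perm.one_apply] at h3
  exact h3.symm

/-- The trivial rack. -/
def trivRack (A : Type) : RackS A where
  act a _ := a
  invAct a _ := a
  self_distrib _ _ _ := rfl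
  self_distrib_inv _ _ _ := rfl
  act_invAct _ _ := rfl
  invAct_act _ _ := rfl

/-- Free groups on one more generator. -/
abbrev FO (n : ℕ) : Type := FreeGroup (Option (Fin n))

/-- Substitution of `c` for the extra generator. -/
def sbst {n : ℕ} (c : FO n) : FO n →* FO n :=
  FreeGroup.lift (fun a : Option (Fin n) => a.elim c fun i => FreeGroup.of (some i))

theorem sbst_map {n : ℕ} (c : FO n) (u : FreeGroup (Fin n)) :
    sbst c (FreeGroup.map some u) = FreeGroup.map some u := by
  have : (sbst c).comp (FreeGroup.map some) = (FreeGroup.map some : _ →* FO n) := by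
    ext i; simp [sbst]
  exact DFunLike.congr_fun this u

theorem sbst_self {n : ℕ} (s : FO n) : sbst (FreeGroup.of none) s = s := by
  have : sbst (FreeGroup.of none) = MonoidHom.id (FO n) := by
    ext a; cases a <;> simp [sbst]
  exact DFunLike.congr_fun this s

theorem sbst_one {n : ℕ} (s : FO n) : sbst 1 s = FreeGroup.map some (retr n s) := by
  have : sbst (1 : FO n) = (FreeGroup.map some).comp (retr n) := by
    ext a; cases a <;> simp [retr, sbst]
  exact DFunLike.congr_fun this s

theorem family_form {n : ℕ} (π : ∀ (R : Type) (q : RackS R), (FreeRckC n → R) → R → R)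
    (hend : ∀ (R : Type) (q : RackS R) (h : FreeRckC n → R),
      IsRackHom (freeRck n) q h → IsRackHom q q (π R q h))
    (hbij : ∀ (R : Type) (q : RackS R) (h : FreeRckC n → R),
        IsRackHom (freeRck n) q h → Function.Bijective (π R q h))
    (hnat : ∀ (R : Type) (q : RackS R) (R' : Type) (q' : RackS R')
        (h : FreeRckC n → R) (f : R → R'),
        IsRackHom (freeRck n) q h → IsRackHom q q' f →
        f ∘ π R q h = π R' q' (f ∘ h) ∘ f) :
    ∃ (z : ℤ) (w : FreeGroup (Fin n)),
      π _ (augRack (FreeGroup.of : Option (Fin n) → _)) (incl n) (none, 1) =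
        (none, FreeGroup.of none ^ z * FreeGroup.map some w) := by
  obtain ⟨⟨a, s⟩, hu⟩ : ∃ u, π _ (augRack (FreeGroup.of : Option (Fin n) → _))
    (incl n) (none, 1) = u := ⟨_, rfl⟩
  rw [hu]
  -- the first coordinate is `none`
  have ha : a = none := by
    cases a with
    | none => rfl
    | some i =>
      exfalso
      have key : ∀ r : Bool, π Bool (trivRack Bool) (fun _ => false) r = false := by
        intro r
        have h1 := hnat _ _ Bool (trivRack Bool) (incl n)
          (fun p => (p.1.elim r fun _ => false : Bool)) (incl_hom n)
          ⟨fun _ _ => rfl, fun _ _ => rfl⟩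
        have h2 := congrFun h1 (none, 1)
        simp only [Function.comp_apply, hu] at h2
        exact h2.symm
      have hb := hbij Bool (trivRack Bool) (fun _ => false)
        ⟨fun _ _ => rfl, fun _ _ => rfl⟩
      have := hb.1 ((key true).trans (key false).symm)
      exact absurd this (by decide)
  subst ha
  -- the rack `V` on `F × F`
  let hV : FreeRckC n → FO n × FO n := fun p => (FreeGroup.of (some p.1), FreeGroup.map some p.2)
  have hVhom : IsRackHom (freeRck n) (augRack (id : FO n → FO n)) hV := by
    constructor
    · intro a b
      refine Prod.ext rfl ?_
      simp [hV, augRack, freeRck]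
    · intro a b
      refine Prod.ext rfl ?_
      simp [hV, augRack, freeRck]
  have hS : ∀ c t : FO n, t⁻¹ * c * t = c →
      π _ (augRack (id : FO n → FO n)) hV (c, t) = (c, t * sbst c s) := by
    intro c t hct
    have h1 := hnat _ _ _ (augRack (id : FO n → FO n)) (incl n) _ (incl_hom n)
      (augRack_hom (FreeGroup.of : Option (Fin n) → FO n) (id : FO n → FO n)
        (fun a => a.elim c fun i => FreeGroup.of (some i))
        (fun a => a.elim t fun _ => 1)
        (sbst c)
        (by
          intro a
          cases a with
          | none => simpa [sbst] using hct.symm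
          | some i => simp [sbst]))
    have h2 : (fun p : Option (Fin n) × FO n =>
        ((p.1.elim c fun i => FreeGroup.of (some i) : FO n),
          (p.1.elim t fun _ => 1 : FO n) * sbst c p.2)) ∘ incl n = hV := by
      funext p
      obtain ⟨i, u⟩ := p
      refine Prod.ext rfl ?_
      exact (one_mul _).trans (sbst_map c u)
    have h3 := congrFun h1 (none, 1)
    simp only [Function.comp_apply, hu] at h3
    have h4 : π _ (augRack (id : FO n → FO n)) hV (c, t * sbst c 1) = (c, t * sbst c s) := by
      rw [← h2]
      exact h3.symm
    simpa using h4
  have e1 := hS 1 1 (by simp)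
  have e2 := hS (FreeGroup.of none) 1 (by simp)
  have e3 := hS 1 (FreeGroup.of none) (by simp)
  have hm := (hend _ _ hV hVhom).1 (1, 1) (FreeGroup.of none, 1)
  have hact : (augRack (id : FO n → FO n)).act (1, 1) (FreeGroup.of none, 1)
      = (1, FreeGroup.of none) := by
    simp [augRack]
  rw [hact, e1, e2, e3] at hm
  have hm2 : FreeGroup.of none * sbst 1 s =
      (1 * sbst 1 s) * (1 * sbst (FreeGroup.of none) s)⁻¹ * FreeGroup.of none
        * (1 * sbst (FreeGroup.of none) s) := congrArg Prod.snd hm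
  rw [sbst_self, one_mul, one_mul] at hm2
  have hcomm : FreeGroup.of none * (s * (sbst 1 s)⁻¹) = (s * (sbst 1 s)⁻¹) * FreeGroup.of none := by
    have h5 : FreeGroup.of none * s = s * (sbst 1 s)⁻¹ * (FreeGroup.of none * sbst 1 s) := by
      rw [hm2]; group
    rw [← mul_assoc, h5]; group
  obtain ⟨z, hz⟩ := aux_centralizer' none _ hcomm
  refine ⟨z, retr n s, ?_⟩
  rw [← hz, ← sbst_one]
  simp

/-- **Corollary 6.1 of the paper.** Let `π` assign to each rack `R` and each
rack homomorphism `h : Rₙ → R` a rack endomorphism `π_h : R → R`.  Then `π` is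
a natural family of automorphisms over `Rₙ` (each `π_h` is bijective and
`f ∘ π_h = π_{f ∘ h} ∘ f`) iff there are a unique integer `z` and a unique
reduced word `y_{i₁}^{ε₁} ⋯ y_{iₘ}^{εₘ}` such that for every rack homomorphism
`h : Rₙ → R` and every `r ∈ R`,
`π_h r = r ◁^{δ₁} r ◁^{δ₂} ⋯ ◁^{δ_{|z|}} r ◁^{ε₁} h(y_{i₁}) ◁^{ε₂} ⋯ ◁^{εₘ} h(y_{iₘ})`
(left-associated), where `δ₁ = ⋯ = δ_{|z|} = 1` if `z > 0` and
`δ₁ = ⋯ = δ_{|z|} = -1` if `z < 0`. -/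
theorem natural_family_free_rack (n : ℕ)
    (π : ∀ (R : Type) (q : RackS R), (FreeRckC n → R) → R → R)
    (hend : ∀ (R : Type) (q : RackS R) (h : FreeRckC n → R),
      IsRackHom (freeRck n) q h → IsRackHom q q (π R q h)) :
    ((∀ (R : Type) (q : RackS R) (h : FreeRckC n → R),
        IsRackHom (freeRck n) q h → Function.Bijective (π R q h)) ∧
     (∀ (R : Type) (q : RackS R) (R' : Type) (q' : RackS R')
        (h : FreeRckC n → R) (f : R → R'),
        IsRackHom (freeRck n) q h → IsRackHom q q' f →
        f ∘ π R q h = π R' q' (f ∘ h) ∘ f)) ↔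
    ∃! zw : ℤ × List (Fin n × Bool), ReducedWord zw.2 ∧
      ∀ (R : Type) (q : RackS R) (h : FreeRckC n → R),
        IsRackHom (freeRck n) q h →
        ∀ r : R, π R q h r =
          q.chainAct r
            (List.replicate zw.1.natAbs (r, decide (0 < zw.1)) ++
              zw.2.map fun p => (h (yR n p.1), p.2)) := by
  constructor
  · rintro ⟨hbij, hnat⟩
    obtain ⟨z, w, hzw⟩ := family_form π hend hbij hnat
    refine ⟨(z, w.toWord), ⟨FreeGroup.isReduced_toWord, ?_⟩, ?_⟩
    · intro R q h hh r
      rw [family_eval π hnat R q h hh r, hzw]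
      dsimp only
      rw [chain_list_eq, chainAct_eval, mk_zwWord, FreeGroup.mk_toWord]
      rfl
    · rintro ⟨z', w'⟩ ⟨hred, hform⟩
      have h1 := hform _ _ (incl n) (incl_hom n) (none, 1)
      dsimp only at h1
      rw [hzw, chain_list_eq] at h1
      have h2 : (fun p : Option (Fin n) × Bool => (gval (incl n) (none, 1) p.1, p.2)) =
          fun p => ((p.1, 1), p.2) := by
        funext p
        obtain ⟨a, b⟩ := p
        cases a
        · rfl
        · simp [gval, incl, yR]
      rw [h2, augRack_chain, mk_zwWord, one_mul] at h1
      have h3 := congrArg Prod.snd h1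
      dsimp only at h3
      have h4 := congrArg (retr n) h3
      rw [map_mul, map_mul, retr_map, retr_map, map_zpow, map_zpow] at h4
      have h5 : retr n (FreeGroup.of none) = 1 := by simp [retr]
      rw [h5, one_zpow, one_zpow, one_mul, one_mul] at h4
      rw [← h4] at h3
      have h6 := mul_right_cancel h3
      have h7 := congrArg (FreeGroup.lift
        (fun _ : Option (Fin n) => Multiplicative.ofAdd (1 : ℤ))) h6
      rw [map_zpow, map_zpow, FreeGroup.lift_apply_of, ← ofAdd_zsmul, ← ofAdd_zsmul] at h7
      have h8 : z = z' := by simpa using h7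
      have h9 : w.toWord = w' := by
        rw [h4, FreeGroup.toWord_mk]
        exact FreeGroup.IsReduced.reduce_eq hred
      rw [h8, h9]
  · rintro ⟨⟨z, w⟩, ⟨_, hform⟩, _⟩
    dsimp only at hform
    constructor
    · intro R q h hh
      have : π R q h = (evalP q (fun i => h (yR n i)) (FreeGroup.mk w)) ∘
          (fun r => (rTrans q r ^ z) r) := by
        funext r
        rw [hform R q h hh r, chain_eq]
        rfl
      rw [this]
      exact (Equiv.bijective _).comp (twist_bij q z)
    · intro R q R' q' h f hh hf
      funext r
      have hfh : IsRackHom (freeRck n) q' (f ∘ h) :=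
        ⟨fun a b => by simp [hh.1, hf.1], fun a b => by simp [hh.2, hf.2]⟩
      rw [Function.comp_apply, Function.comp_apply, hform R q h hh r,
        hform R' q' (f ∘ h) hfh (f r), hom_chainAct q q' f hf]
      simp [Function.comp_def]
end
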